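/- arXiv:1808.09245 — 2 statements merged into one kernel-verified Lean document; each statement's English description precedes it below -/
import Mathlib

section
/- For all integers n ≥ 2 and k ≥ 1, gr_k(K_3 : C_{2n+1}) ≤ (2^{k+3} − 3)·n·log n, where log denotes the base-2 logarithm; that is, for every integer N ≥ (2^{k+3} − 3)·n·log n, every k-coloring of the edges of K_N contains a rainbow triangle or a monochromatic copy of C_{2n+1}. -/
open SimpleGraph

/-- The edge coloring `c` of the complete graph on `V` contains a rainbow triangle. -/
def HasRainbowTriangle {V α : Type*} (c : Sym2 V → α) : Prop :=
  ∃ x y z : V, x ≠ y ∧ x ≠ z ∧ y ≠ z ∧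
    c s(x, y) ≠ c s(x, z) ∧ c s(x, y) ≠ c s(y, z) ∧ c s(x, z) ≠ c s(y, z)

/-- The edge coloring `c` contains a copy of `H` all of whose edges have color `i`. -/
def HasMonoCopyIn {V W α : Type*} (c : Sym2 V → α) (H : SimpleGraph W) (i : α) : Prop :=
  ∃ f : W ↪ V, ∀ u v, H.Adj u v → c s(f u, f v) = i

/-- The edge coloring `c` contains a monochromatic copy of `H`. -/
def HasMonoCopy {V W α : Type*} (c : Sym2 V → α) (H : SimpleGraph W) : Prop :=
  ∃ i, HasMonoCopyIn c H i

/-- Every `k`-coloring of the edges of `K_n` contains a rainbow triangle or a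
monochromatic copy of `H`. -/
def grProp {W : Type*} (k : ℕ) (H : SimpleGraph W) (n : ℕ) : Prop :=
  ∀ c : Sym2 (Fin n) → Fin k, HasRainbowTriangle c ∨ HasMonoCopy c H

/-- The `k`-color Gallai–Ramsey number `gr_k(K₃ : H)`: the minimum `N` such that for all
`n ≥ N`, every `k`-coloring of the edges of `K_n` contains a rainbow triangle or a
monochromatic copy of `H`. -/
noncomputable def gr {W : Type*} (k : ℕ) (H : SimpleGraph W) : ℕ :=
  sInf {N | ∀ n, N ≤ n → grProp k H n}


/-- A monochromatic closed cycle of length `2n+1`, as a function on naturals. -/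
def MonoCyc {V α : Type} (d : V → V → α) (n : ℕ) (i : α) : Prop :=
  ∃ g : ℕ → V, (∀ s t, s < 2 * n + 1 → t < 2 * n + 1 → g s = g t → s = t) ∧
    (∀ j, j < 2 * n → d (g j) (g (j + 1)) = i) ∧ d (g (2 * n)) (g 0) = i

theorem exists_enum {V : Type} [DecidableEq V] (X : Finset V) (m : ℕ) (hX : m ≤ X.card)
    (v0 : V) :
    ∃ e : ℕ → V, (∀ i, i < m → e i ∈ X) ∧ ∀ i j, i < m → j < m → e i = e j → i = j := by
  refine ⟨fun i => X.toList.getD i v0, ?_, ?_⟩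
  · intro i hi
    have h : i < X.toList.length := by simp; omega
    simp only [List.getD_eq_getElem _ _ h]
    exact Finset.mem_toList.1 (List.getElem_mem h)
  · intro i j hi hj h
    have h1 : i < X.toList.length := by simp; omega
    have h2 : j < X.toList.length := by simp; omega
    simp only [List.getD_eq_getElem _ _ h1, List.getD_eq_getElem _ _ h2] at h
    exact (List.Nodup.getElem_inj_iff (Finset.nodup_toList X)).1 h

theorem cyc_bip {V α : Type} [DecidableEq V] (d : V → V → α) (hd : ∀ x y, d x y = d y x)
    (n : ℕ) (hn : 2 ≤ n) (i : α) (X Y : Finset V)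
    (hX : n + 1 ≤ X.card) (hY : n ≤ Y.card) (hXY : Disjoint X Y)
    (hc : ∀ x ∈ X, ∀ y ∈ Y, d x y = i)
    (u w : V) (hu : u ∈ X) (hw : w ∈ X) (huw : u ≠ w) (huwi : d u w = i) : MonoCyc d n i := by
  obtain ⟨e, he, hei⟩ := exists_enum ((X.erase u).erase w) (n - 1) (by
    rw [Finset.card_erase_of_mem (by simp [hw, huw.symm]), Finset.card_erase_of_mem hu]; omega) u
  obtain ⟨y, hy, hyi⟩ := exists_enum Y n hY u
  have he' : ∀ i, i < n - 1 → e i ∈ X ∧ e i ≠ u ∧ e i ≠ w := by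
    intro i hi
    have := he i hi
    simp only [Finset.mem_erase] at this
    tauto
  let x : ℕ → V := fun j => if j = 0 then u else if j = n then w else e (j - 1)
  have hx0 : x 0 = u := by simp [x]
  have hxn : x n = w := by simp [x]; omega
  have hxe : ∀ j, j ≠ 0 → j ≠ n → x j = e (j - 1) := by intro j h1 h2; simp [x, h1, h2]
  have hxX : ∀ j, j ≤ n → x j ∈ X := by
    intro j hj
    by_cases h0 : j = 0
    · subst h0; rw [hx0]; exact hu
    by_cases h1 : j = n
    · subst h1; rw [hxn]; exact hw
    rw [hxe j h0 h1]; exact (he' _ (by omega)).1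
  have hxi : ∀ s t, s ≤ n → t ≤ n → x s = x t → s = t := by
    intro s t hs ht h
    by_cases s0 : s = 0 <;> by_cases s1 : s = n <;> by_cases t0 : t = 0 <;> by_cases t1 : t = n <;>
      first
      | omega
      | skip
    · subst s0; subst t1; rw [hx0, hxn] at h; exact absurd h huw
    · subst s0; rw [hx0, hxe t t0 t1] at h; exact absurd h.symm (he' _ (by omega)).2.1
    · subst s1; subst t0; rw [hx0, hxn] at h; exact absurd h.symm huw
    · subst s1; rw [hxn, hxe t t0 t1] at h; exact absurd h.symm (he' _ (by omega)).2.2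
    · subst t0; rw [hx0, hxe s s0 s1] at h; exact absurd h (he' _ (by omega)).2.1
    · subst t1; rw [hxn, hxe s s0 s1] at h; exact absurd h (he' _ (by omega)).2.2
    · rw [hxe s s0 s1, hxe t t0 t1] at h
      have := hei _ _ (by omega) (by omega) h
      omega
  have hne : ∀ s t, s ≤ n → t < n → x s ≠ y t := by
    intro s t hs ht h
    exact (Finset.disjoint_left.1 hXY (hxX s hs)) (h ▸ hy t ht)
  let g : ℕ → V := fun j => if j % 2 = 0 then x (j / 2) else y (j / 2)
  refine ⟨g, ?_, ?_, ?_⟩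
  · intro s t hs ht h
    by_cases h1 : s % 2 = 0 <;> by_cases h2 : t % 2 = 0 <;> simp only [g, h1, h2, if_true, if_false] at h
    · have := hxi _ _ (by omega) (by omega) h; omega
    · exact absurd h (hne _ _ (by omega) (by omega))
    · exact absurd h.symm (hne _ _ (by omega) (by omega))
    · have := hyi _ _ (by omega) (by omega) h; omega
  · intro j hj
    by_cases h1 : j % 2 = 0
    · have h2 : ¬ (j + 1) % 2 = 0 := by omega
      simp only [g, h1, h2, if_true, if_false]
      exact hc _ (hxX _ (by omega)) _ (hy _ (by omega))
    · have h2 : (j + 1) % 2 = 0 := by omega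
      simp only [g, h1, h2, if_true, if_false]
      rw [hd]
      exact hc _ (hxX _ (by omega)) _ (hy _ (by omega))
  · have h1 : (2 * n) % 2 = 0 := by omega
    have h2 : 2 * n / 2 = n := by omega
    simp only [g, h1, h2, if_true]
    simp only [Nat.zero_mod, if_true, Nat.zero_div, hx0, hxn]
    rw [hd]; exact huwi

theorem cyc_penta {V α : Type} [DecidableEq V] (d : V → V → α) (hd : ∀ x y, d x y = d y x)
    (n : ℕ) (hn : 2 ≤ n) (i : α) (X Y : Finset V)
    (hX : n ≤ X.card) (hY : n ≤ Y.card) (hXY : Disjoint X Y)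
    (hc : ∀ x ∈ X, ∀ y ∈ Y, d x y = i)
    (u v w : V) (hu : u ∉ X ∧ u ∉ Y) (hv : v ∉ X ∧ v ∉ Y) (hw : w ∉ X ∧ w ∉ Y)
    (huv : u ≠ v) (huw : u ≠ w) (hvw : v ≠ w)
    (h1 : ∀ y ∈ Y, d y u = i) (h2 : d u v = i) (h3 : d v w = i) (h4 : ∀ x ∈ X, d w x = i) :
    MonoCyc d n i := by
  obtain ⟨x, hx, hxi⟩ := exists_enum X n hX u
  obtain ⟨y, hy, hyi⟩ := exists_enum Y n hY u
  have hne : ∀ s t, s < n → t < n → x s ≠ y t := by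
    intro s t hs ht h
    exact (Finset.disjoint_left.1 hXY (hx s hs)) (h ▸ hy t ht)
  let g0 : ℕ → V := fun j => if j % 2 = 0 then x (j / 2) else y (j / 2)
  have hg0 : ∀ j, j < 2 * n → g0 j ∈ X ∨ g0 j ∈ Y := by
    intro j hj
    by_cases h1 : j % 2 = 0
    · left; simp only [g0, h1, if_true]; exact hx _ (by omega)
    · right; simp only [g0, h1, if_false]; exact hy _ (by omega)
  have hg0i : ∀ s t, s < 2 * n → t < 2 * n → g0 s = g0 t → s = t := by
    intro s t hs ht h
    by_cases h1 : s % 2 = 0 <;> by_cases h2 : t % 2 = 0 <;> simp only [g0, h1, h2, if_true, if_false] at h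
    · have := hxi _ _ (by omega) (by omega) h; omega
    · exact absurd h (hne _ _ (by omega) (by omega))
    · exact absurd h.symm (hne _ _ (by omega) (by omega))
    · have := hyi _ _ (by omega) (by omega) h; omega
  have hg0u : ∀ j, j < 2 * n → g0 j ≠ u ∧ g0 j ≠ v ∧ g0 j ≠ w := by
    intro j hj
    refine ⟨?_, ?_, ?_⟩ <;> intro h <;> have := hg0 j hj <;> rw [h] at this <;> tauto
  let g : ℕ → V := fun j => if j < 2 * n - 2 then g0 j else if j = 2 * n - 2 then u else
    if j = 2 * n - 1 then v else w
  have ga : ∀ j, j < 2 * n - 2 → g j = g0 j := by intro j hj; simp [g, hj]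
  have gu : g (2 * n - 2) = u := by simp [g]
  have gv : g (2 * n - 1) = v := by
    have : ¬ (2 * n - 1 < 2 * n - 2) := by omega
    have h' : ¬ (2 * n - 1 = 2 * n - 2) := by omega
    simp only [g, this, h', if_false, if_true]
  have gw : g (2 * n) = w := by
    have : ¬ (2 * n < 2 * n - 2) := by omega
    have h' : ¬ (2 * n = 2 * n - 2) := by omega
    have h'' : ¬ (2 * n = 2 * n - 1) := by omega
    simp only [g, this, h', h'', if_false]
  have cases4 : ∀ j, j < 2 * n + 1 → j < 2 * n - 2 ∨ j = 2 * n - 2 ∨ j = 2 * n - 1 ∨ j = 2 * n := by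
    intro j hj; omega
  refine ⟨g, ?_, ?_, ?_⟩
  · intro s t hs ht h
    rcases cases4 s hs with a | a | a | a <;> rcases cases4 t ht with b | b | b | b <;>
      first
      | (subst a; subst b; rfl)
      | skip
    · rw [ga s a, ga t b] at h; exact hg0i s t (by omega) (by omega) h
    all_goals
      first
      | rw [ga s a] at h
        have := hg0u s (by omega)
        rw [b] at h; simp only [gu, gv, gw] at h; tauto
      | rw [ga t b] at h
        have := hg0u t (by omega)
        rw [a] at h; simp only [gu, gv, gw] at h
        have h := h.symm
        tauto
      | rw [a, b] at h; simp only [gu, gv, gw] at h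
        first
        | exact absurd h (by assumption)
        | exact absurd h.symm (by assumption)
  · intro j hj
    by_cases hj1 : j + 1 < 2 * n - 2
    · rw [ga _ hj1, ga j (by omega)]
      by_cases h1 : j % 2 = 0
      · have h2 : ¬ (j + 1) % 2 = 0 := by omega
        simp only [g0, h1, h2, if_true, if_false]
        exact hc _ (hx _ (by omega)) _ (hy _ (by omega))
      · have h2 : (j + 1) % 2 = 0 := by omega
        simp only [g0, h1, h2, if_true, if_false]
        rw [hd]
        exact hc _ (hx _ (by omega)) _ (hy _ (by omega))
    · by_cases e1 : j + 1 = 2 * n - 2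
      · rw [e1, gu, ga j (by omega)]
        have h2 : ¬ j % 2 = 0 := by omega
        simp only [g0, h2, if_false]
        exact h1 _ (hy _ (by omega))
      · by_cases e2 : j = 2 * n - 2
        · have : j + 1 = 2 * n - 1 := by omega
          rw [this, e2, gu, gv]; exact h2
        · have e3 : j = 2 * n - 1 := by omega
          have : j + 1 = 2 * n := by omega
          rw [this, e3, gw, gv]; exact h3
  · rw [gw, ga 0 (by omega)]
    exact h4 _ (hx _ (by omega))

theorem cyc_multi {V α : Type} [DecidableEq V] (d : V → V → α) (hd : ∀ x y, d x y = d y x)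
    (n : ℕ) (hn : 2 ≤ n) (i : α) (X : Finset V) (p : V → ℕ)
    (hX : 2 * n + 1 ≤ X.card) (hp : ∀ t, (X.filter (fun v => p v = t)).card ≤ n)
    (hc : ∀ x ∈ X, ∀ y ∈ X, p x ≠ p y → d x y = i) : MonoCyc d n i := by
  set l := X.toList.mergeSort (fun a b => decide (p a ≤ p b)) with hl
  have hperm : l.Perm X.toList := List.mergeSort_perm _ _
  have hnd : l.Nodup := hperm.nodup_iff.2 X.nodup_toList
  have hlen : l.length = X.card := by rw [hperm.length_eq]; simp
  have hsort : l.Pairwise (fun a b => p a ≤ p b) := by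
    have := List.pairwise_mergeSort (le := fun a b => decide (p a ≤ p b))
      (by intro a b c; simp; omega) (by intro a b; simp; omega) X.toList
    simpa using this
  have hv0 : ∃ v0 : V, v0 ∈ X := Finset.card_pos.1 (by omega)
  obtain ⟨v0, -⟩ := hv0
  let x : ℕ → V := fun j => l.getD j v0
  have hxg : ∀ j (h : j < l.length), x j = l[j] := fun j h => List.getD_eq_getElem _ _ h
  have hxX : ∀ j, j < 2 * n + 1 → x j ∈ X := by
    intro j hj
    rw [hxg j (by omega)]
    exact Finset.mem_toList.1 (hperm.mem_iff.1 (List.getElem_mem _))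
  have hxi : ∀ s t, s < 2 * n + 1 → t < 2 * n + 1 → x s = x t → s = t := by
    intro s t hs ht h
    rw [hxg s (by omega), hxg t (by omega)] at h
    exact hnd.getElem_inj_iff.1 h
  have hmono : ∀ s t, s ≤ t → t < 2 * n + 1 → p (x s) ≤ p (x t) := by
    intro s t hs ht
    rcases Nat.eq_or_lt_of_le hs with rfl | hs
    · exact le_rfl
    rw [hxg s (by omega), hxg t (by omega)]
    exact List.pairwise_iff_getElem.1 hsort s t _ _ hs
  have hdiff : ∀ s t, s + n ≤ t → t < 2 * n + 1 → p (x s) ≠ p (x t) := by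
    intro s t hs ht h
    have hsub : (Finset.Icc s t).image x ⊆ X.filter (fun v => p v = p (x s)) := by
      intro v hv
      simp only [Finset.mem_image, Finset.mem_Icc] at hv
      obtain ⟨j, ⟨h1, h2⟩, rfl⟩ := hv
      simp only [Finset.mem_filter]
      refine ⟨hxX _ (by omega), le_antisymm ?_ (hmono _ _ h1 (by omega))⟩
      rw [h]; exact hmono _ _ h2 ht
    have h1 := Finset.card_le_card hsub
    rw [Finset.card_image_of_injOn] at h1
    · have := hp (p (x s))
      simp at h1
      omega
    · intro a ha b hb hab
      simp at ha hb
      exact hxi _ _ (by omega) (by omega) hab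
  have hcol : ∀ s t, s + n ≤ t → t < 2 * n + 1 → d (x s) (x t) = i := fun s t h1 h2 =>
    hc _ (hxX _ (by omega)) _ (hxX _ h2) (hdiff s t h1 h2)
  let q : ℕ → ℕ := fun j => if j % 2 = 0 then n - j / 2 else 2 * n - j / 2
  refine ⟨fun j => x (q j), ?_, ?_, ?_⟩
  · intro s t hs ht h
    have hqs : q s < 2 * n + 1 := by simp only [q]; split_ifs <;> omega
    have hqt : q t < 2 * n + 1 := by simp only [q]; split_ifs <;> omega
    have := hxi _ _ hqs hqt h
    simp only [q] at this
    split_ifs at this <;> omega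
  · intro j hj
    by_cases h1 : j % 2 = 0
    · have h2 : ¬ (j + 1) % 2 = 0 := by omega
      simp only [q, h1, h2, if_true, if_false]
      exact hcol _ _ (by omega) (by omega)
    · have h2 : (j + 1) % 2 = 0 := by omega
      simp only [q, h1, h2, if_true, if_false]
      rw [hd]
      exact hcol _ _ (by omega) (by omega)
  · have h1 : (2 * n) % 2 = 0 := by omega
    simp only [q, h1, if_true]
    simp only [Nat.zero_mod, if_true, Nat.zero_div]
    exact hcol _ _ (by omega) (by omega)

theorem dfs {V : Type} [DecidableEq V] (r : V → V → Prop) (B : Finset V) :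
    ∀ m : ℕ, ∀ (X Y : Finset V) (l : List V), 2 * Y.card + l.length = m → X ⊆ B → Y ⊆ B →
      (∀ v ∈ l, v ∈ B) → l.Nodup → l.IsChain r → Disjoint X Y → (∀ v ∈ l, v ∉ X ∧ v ∉ Y) →
      B.card = X.card + Y.card + l.length → (∀ x ∈ X, ∀ y ∈ Y, ¬ r y x) → X.card ≤ Y.card →
      ∃ (X Y : Finset V) (l : List V), X ⊆ B ∧ Y ⊆ B ∧
      (∀ v ∈ l, v ∈ B) ∧ l.Nodup ∧ l.IsChain r ∧ Disjoint X Y ∧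
      B.card = X.card + Y.card + l.length ∧ (∀ x ∈ X, ∀ y ∈ Y, ¬ r y x) ∧ X.card = Y.card := by
  intro m
  induction m using Nat.strong_induction_on with
  | _ m ih =>
    intro X Y l hm hX hY hl hnd hch hdis hlXY hcard hr hle
    rcases Nat.eq_or_lt_of_le hle with heq | hlt
    · exact ⟨X, Y, l, hX, hY, hl, hnd, hch, hdis, hcard, hr, heq⟩
    by_cases hpush : ∃ y ∈ Y, (y :: l).IsChain r
    · obtain ⟨y, hy, hyc⟩ := hpush
      have hc1 : (Y.erase y).card = Y.card - 1 := Finset.card_erase_of_mem hy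
      have hyX : y ∉ X := fun h => Finset.disjoint_left.1 hdis h hy
      have hyl : y ∉ l := fun h => (hlXY y h).2 hy
      refine ih (2 * (Y.erase y).card + (y :: l).length) ?_ X (Y.erase y) (y :: l) rfl hX
        ((Finset.erase_subset _ _).trans hY) ?_ ?_ hyc ?_ ?_ ?_ ?_ ?_
      · simp only [List.length_cons]; omega
      · intro v hv
        rcases List.mem_cons.1 hv with rfl | hv
        · exact hY hy
        · exact hl v hv
      · exact List.nodup_cons.2 ⟨hyl, hnd⟩
      · exact hdis.mono_right (Finset.erase_subset _ _)
      · intro v hv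
        rcases List.mem_cons.1 hv with rfl | hv
        · exact ⟨hyX, by simp⟩
        · exact ⟨(hlXY v hv).1, fun h => (hlXY v hv).2 (Finset.mem_of_mem_erase h)⟩
      · simp only [List.length_cons]; omega
      · intro x hx z hz; exact hr x hx z (Finset.mem_of_mem_erase hz)
      · omega
    · cases l with
      | nil =>
        exfalso
        obtain ⟨y, hy⟩ := Finset.card_pos.1 (show 0 < Y.card by omega)
        exact hpush ⟨y, hy, by simp⟩
      | cons v l =>
        have hv := hlXY v (by simp)
        have hc1 : (insert v X).card = X.card + 1 := Finset.card_insert_of_notMem hv.1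
        have hnd' := List.nodup_cons.1 hnd
        refine ih (2 * Y.card + l.length) ?_ (insert v X) Y l rfl ?_ hY ?_ hnd'.2 ?_ ?_ ?_ ?_ ?_ ?_
        · simp only [List.length_cons] at hm; omega
        · intro z hz
          rcases Finset.mem_insert.1 hz with rfl | hz
          · exact hl _ (by simp)
          · exact hX hz
        · intro z hz; exact hl z (by simp [hz])
        · exact List.IsChain.tail hch
        · rw [Finset.disjoint_insert_left]; exact ⟨hv.2, hdis⟩
        · intro z hz
          have := hlXY z (by simp [hz])
          refine ⟨?_, this.2⟩
          rw [Finset.mem_insert]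
          rintro (rfl | h)
          · exact hnd'.1 hz
          · exact this.1 h
        · simp only [List.length_cons] at hcard; omega
        · intro x hx y hy
          rcases Finset.mem_insert.1 hx with rfl | hx
          · intro hry
            exact hpush ⟨y, hy, List.isChain_cons_cons.2 ⟨hry, hch⟩⟩
          · exact hr x hx y hy
        · omega


theorem split_parts {V : Type} [DecidableEq V] (n : ℕ) (hn : 2 ≤ n) (X Y : Finset V) (p : V → ℕ)
    (hX : 4 * n ≤ X.card) (hY : 4 * n ≤ Y.card)
    (hpX : ∀ t, (X.filter (fun v => p v = t)).card ≤ n)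
    (hpY : ∀ t, (Y.filter (fun v => p v = t)).card ≤ n) :
    ∃ X' Y' : Finset V, X' ⊆ X ∧ Y' ⊆ Y ∧ (∀ x ∈ X', ∀ y ∈ Y', p x ≠ p y) ∧
      ((2 * n + 1 ≤ X'.card ∧ n ≤ Y'.card) ∨ (2 * n + 1 ≤ Y'.card ∧ n ≤ X'.card)) := by
  have hex : ∃ t, n ≤ (X.filter (fun v => p v < t)).card ∨ n ≤ (Y.filter (fun v => p v < t)).card := by
    refine ⟨X.sup p + 1, Or.inl ?_⟩
    rw [Finset.filter_true_of_mem]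
    · omega
    · intro v hv; exact Nat.lt_succ_of_le (Finset.le_sup hv)
  classical
  obtain ⟨t, ht, hmin⟩ : ∃ t, (n ≤ (X.filter (fun v => p v < t)).card ∨
      n ≤ (Y.filter (fun v => p v < t)).card) ∧ ∀ m < t, ¬ (n ≤ (X.filter (fun v => p v < m)).card ∨
      n ≤ (Y.filter (fun v => p v < m)).card) :=
    ⟨Nat.find hex, Nat.find_spec hex, fun m hm => Nat.find_min hex hm⟩
  cases t with
  | zero => simp at ht; omega
  | succ t =>
    have h1 := hmin t (by omega)
    push Not at h1
    have hs : ∀ Z : Finset V, (Z.filter (fun v => p v < t + 1)).card ≤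
        (Z.filter (fun v => p v < t)).card + (Z.filter (fun v => p v = t)).card := by
      intro Z
      rw [← Finset.card_union_of_disjoint]
      · apply Finset.card_le_card
        intro v hv
        simp only [Finset.mem_filter, Finset.mem_union] at hv ⊢
        have : p v < t ∨ p v = t := by omega
        tauto
      · rw [Finset.disjoint_filter]; intro v _ h; omega
    have hs2 : ∀ Z : Finset V, (Z.filter (fun v => p v < t + 1)).card +
        (Z.filter (fun v => ¬ p v < t + 1)).card = Z.card := fun Z =>
      Finset.card_filter_add_card_filter_not _
    have a1 := hs X
    have a2 := hs Y
    have b1 := hs2 X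
    have b2 := hs2 Y
    have c1 := hpX t
    have c2 := hpY t
    rcases ht with ht | ht
    · refine ⟨X.filter (fun v => p v < t + 1), Y.filter (fun v => ¬ p v < t + 1),
        Finset.filter_subset _ _, Finset.filter_subset _ _, ?_, Or.inr ⟨by omega, ht⟩⟩
      intro x hx y hy
      simp only [Finset.mem_filter] at hx hy
      omega
    · refine ⟨X.filter (fun v => ¬ p v < t + 1), Y.filter (fun v => p v < t + 1),
        Finset.filter_subset _ _, Finset.filter_subset _ _, ?_, Or.inl ⟨by omega, ht⟩⟩
      intro x hx y hy
      simp only [Finset.mem_filter] at hx hy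
      omega

theorem cyc_path {V α : Type} [DecidableEq V] (d : V → V → α) (hd : ∀ x y, d x y = d y x)
    (n : ℕ) (hn : 2 ≤ n) (i : α) (v : V) (l : List V) (hl : 2 * n ≤ l.length) (hnd : l.Nodup)
    (hch : l.IsChain (fun x y => d x y = i)) (hv : ∀ x ∈ l, x ≠ v ∧ d v x = i) :
    MonoCyc d n i := by
  let x : ℕ → V := fun j => l.getD j v
  have hxg : ∀ j (h : j < l.length), x j = l[j] := fun j h => List.getD_eq_getElem _ _ h
  have hxl : ∀ j, j < 2 * n → x j ∈ l := by
    intro j hj; rw [hxg j (by omega)]; exact List.getElem_mem _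
  refine ⟨fun j => if j = 2 * n then v else x j, ?_, ?_, ?_⟩
  · intro s t hs ht h
    by_cases h1 : s = 2 * n <;> by_cases h2 : t = 2 * n <;> simp only [h1, h2, if_true, if_false] at h
    · omega
    · exact absurd h.symm (hv _ (hxl t (by omega))).1
    · exact absurd h (hv _ (hxl s (by omega))).1
    · rw [hxg s (by omega), hxg t (by omega)] at h
      exact hnd.getElem_inj_iff.1 h
  · intro j hj
    have h1 : ¬ j = 2 * n := by omega
    by_cases h2 : j + 1 = 2 * n
    · simp only [h1, h2, if_true, if_false]
      rw [hd]; exact (hv _ (hxl j (by omega))).2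
    · simp only [h1, h2, if_false]
      rw [hxg j (by omega), hxg (j + 1) (by omega)]
      exact List.isChain_iff_getElem.1 hch j (by omega)
  · have h1 : ¬ 0 = 2 * n := by omega
    simp only [h1, if_true, if_false]
    exact (hv _ (hxl 0 (by omega))).2

theorem small_nbhd {V α : Type} [DecidableEq V] [DecidableEq α] (d : V → V → α)
    (hd : ∀ x y, d x y = d y x)
    (n : ℕ) (hn : 2 ≤ n) (B : Finset V) (p : V → ℕ) (a b : α) (v : V)
    (hB : 10 * n ≤ B.card) (hp : ∀ t, (B.filter (fun v => p v = t)).card ≤ n)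
    (hab : ∀ x ∈ B, ∀ y ∈ B, p x ≠ p y → d x y = a ∨ d x y = b)
    (hv : ∀ x ∈ B, x ≠ v ∧ d v x = a) : MonoCyc d n a ∨ MonoCyc d n b := by
  obtain ⟨X, Y, l, hX, hY, hl, hnd, hch, hdis, hcard, hr, heq⟩ :=
    dfs (fun x y => p x ≠ p y ∧ d x y = a) B _ ∅ B [] rfl (by simp) (by simp) (by simp) (by simp)
      (by simp) (by simp) (by simp) (by simp) (by simp) (by simp)
  by_cases hlen : 2 * n ≤ l.length
  · left
    exact cyc_path d hd n hn a v l hlen hnd (hch.imp (fun _ _ h => h.2)) (fun x hx => hv x (hl x hx))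
  have hfib : ∀ Z ⊆ B, ∀ t, (Z.filter (fun v => p v = t)).card ≤ n := fun Z hZ t =>
    (Finset.card_le_card (Finset.filter_subset_filter _ hZ)).trans (hp t)
  obtain ⟨X', Y', hX', hY', hdiff, hsz⟩ := split_parts n hn X Y p (by omega) (by omega)
    (hfib X hX) (hfib Y hY)
  have hcb : ∀ x ∈ X', ∀ y ∈ Y', d x y = b := by
    intro x hx y hy
    have h1 := hdiff x hx y hy
    have h2 := hr x (hX' hx) y (hY' hy)
    rcases hab x (hX (hX' hx)) y (hY (hY' hy)) h1 with h | h
    · exact absurd ⟨h1.symm, by rw [hd]; exact h⟩ h2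
    · exact h
  have hdis' : Disjoint X' Y' := by
    rw [Finset.disjoint_left]; intro x hx hy; exact hdiff x hx x hy rfl
  have key : ∀ P Q : Finset V, P ⊆ B → 2 * n + 1 ≤ P.card → n ≤ Q.card → Disjoint P Q →
      (∀ x ∈ P, ∀ y ∈ Q, d x y = b) → MonoCyc d n a ∨ MonoCyc d n b := by
    intro P Q hPB hP hQ hPQ hc
    by_cases hb : ∃ u ∈ P, ∃ w ∈ P, u ≠ w ∧ d u w = b
    · obtain ⟨u, hu, w, hw, huw, huwb⟩ := hb
      exact Or.inr (cyc_bip d hd n hn b P Q (by omega) hQ hPQ hc u w hu hw huw huwb)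
    · left
      refine cyc_multi d hd n hn a P p hP (hfib P hPB) ?_
      intro x hx y hy hxy
      rcases hab x (hPB hx) y (hPB hy) hxy with h | h
      · exact h
      · exact absurd ⟨x, hx, y, hy, fun e => hxy (e ▸ rfl), h⟩ hb
  rcases hsz with ⟨h1, h2⟩ | ⟨h1, h2⟩
  · exact key X' Y' (hX'.trans hX) h1 h2 hdis' hcb
  · exact key Y' X' (hY'.trans hY) h1 h2 hdis'.symm (fun x hx y hy => by rw [hd]; exact hcb y hy x hx)

theorem small_case {V α : Type} [DecidableEq V] [DecidableEq α] (d : V → V → α)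
    (hd : ∀ x y, d x y = d y x)
    (n : ℕ) (hn : 2 ≤ n) (M : Finset V) (p : V → ℕ) (a b : α)
    (hM : 21 * n ≤ M.card) (hp : ∀ t, (M.filter (fun v => p v = t)).card ≤ n)
    (hab : ∀ x ∈ M, ∀ y ∈ M, p x ≠ p y → d x y = a ∨ d x y = b) :
    MonoCyc d n a ∨ MonoCyc d n b := by
  obtain ⟨v, hvM⟩ := Finset.card_pos.1 (show 0 < M.card by omega)
  let B1 := M.filter (fun x => p x ≠ p v ∧ d v x = a)
  let B2 := M.filter (fun x => p x ≠ p v ∧ d v x = b)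
  have hsub : M ⊆ M.filter (fun x => p x = p v) ∪ (B1 ∪ B2) := by
    intro x hx
    simp only [B1, B2, Finset.mem_union, Finset.mem_filter]
    by_cases h : p x = p v
    · tauto
    · have := hab v hvM x hx (Ne.symm h); tauto
  have h1 := Finset.card_le_card hsub
  have h2 := Finset.card_union_le (M.filter (fun x => p x = p v)) (B1 ∪ B2)
  have h3 := Finset.card_union_le B1 B2
  have h4 := hp (p v)
  have hfib : ∀ Z ⊆ M, ∀ t, (Z.filter (fun v => p v = t)).card ≤ n := fun Z hZ t =>
    (Finset.card_le_card (Finset.filter_subset_filter _ hZ)).trans (hp t)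
  by_cases h5 : 10 * n ≤ B1.card
  · refine small_nbhd d hd n hn B1 p a b v h5 (hfib _ (Finset.filter_subset _ _)) ?_ ?_
    · intro x hx y hy; exact hab x (Finset.filter_subset _ _ hx) y (Finset.filter_subset _ _ hy)
    · intro x hx
      have := (Finset.mem_filter.1 hx).2
      exact ⟨fun e => this.1 (e ▸ rfl), this.2⟩
  · refine Or.symm (small_nbhd d hd n hn B2 p b a v (by omega) (hfib _ (Finset.filter_subset _ _)) ?_ ?_)
    · intro x hx y hy h
      exact (hab x (Finset.filter_subset _ _ hx) y (Finset.filter_subset _ _ hy) h).symm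
    · intro x hx
      have := (Finset.mem_filter.1 hx).2
      exact ⟨fun e => this.1 (e ▸ rfl), this.2⟩

/-- one step in a color other than `a`, `b` inside `M` -/
def StepRel {V α : Type} (d : V → V → α) (M : Finset V) (a b : α) (x y : V) : Prop :=
  x ∈ M ∧ y ∈ M ∧ d x y ≠ a ∧ d x y ≠ b

theorem step_const {V α : Type} (d : V → V → α) (hd : ∀ x y, d x y = d y x)
    (hr : ∀ x y z, x ≠ y → x ≠ z → y ≠ z → d x y = d x z ∨ d x y = d y z ∨ d x z = d y z)
    (M : Finset V) (a b : α) (x y y' : V) (hx : x ∈ M) (hy : y ∈ M)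
    (hn : ¬ Relation.EqvGen (StepRel d M a b) x y) (he : Relation.EqvGen (StepRel d M a b) y y') :
    d x y = d x y' := by
  have hsymm : ∀ u w, StepRel d M a b u w → StepRel d M a b w u := by
    rintro u w ⟨h1, h2, h3, h4⟩
    exact ⟨h2, h1, by rwa [hd], by rwa [hd]⟩
  have h1 : ∀ y ∈ M, ¬ Relation.EqvGen (StepRel d M a b) x y → d x y = a ∨ d x y = b := by
    intro y hy h
    by_contra hc
    push Not at hc
    exact h (Relation.EqvGen.rel _ _ ⟨hx, hy, hc.1, hc.2⟩)
  have key : ∀ u w, Relation.EqvGen (StepRel d M a b) u w →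
      ¬ Relation.EqvGen (StepRel d M a b) x u → d x u = d x w := by
    intro u w huw
    induction huw with
    | rel u w h =>
      intro hxu
      have hxw : ¬ Relation.EqvGen (StepRel d M a b) x w := fun h' =>
        hxu (h'.trans _ _ _ (Relation.EqvGen.rel _ _ (hsymm _ _ h)))
      obtain ⟨hu, hw, h3, h4⟩ := h
      by_cases e : u = w
      · rw [e]
      have c1 := h1 u hu hxu
      have c2 := h1 w hw hxw
      have nu : x ≠ u := fun e => hxu (e ▸ Relation.EqvGen.refl _)
      have nw : x ≠ w := fun e => hxw (e ▸ Relation.EqvGen.refl _)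
      rcases hr x u w nu nw e with h | h | h
      · exact h
      · exfalso; rw [h] at c1; tauto
      · exfalso; rw [h] at c2; tauto
    | refl u => intro _; rfl
    | symm u w h ih =>
      intro hxw
      exact (ih (fun h' => hxw (h'.trans _ _ _ h))).symm
    | trans u v w h1 h2 ih1 ih2 =>
      intro hxu
      rw [ih1 hxu, ih2 (fun h' => hxu (h'.trans _ _ _ (h1.symm)))]
  exact key y y' he hn

theorem step_cross {V α : Type} (d : V → V → α)
    (M : Finset V) (a b : α) (x y : V) (hx : x ∈ M) (hy : y ∈ M)
    (hn : ¬ Relation.EqvGen (StepRel d M a b) x y) : d x y = a ∨ d x y = b := by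
  by_contra hc
  push Not at hc
  exact hn (Relation.EqvGen.rel _ _ ⟨hx, hy, hc.1, hc.2⟩)

theorem cut_noneq {V α : Type} (d : V → V → α) (hd : ∀ x y, d x y = d y x)
    (M : Finset V) (a b : α) (K : V → Prop)
    (h : ∀ x ∈ M, ∀ y ∈ M, K x → ¬ K y → d x y = a ∨ d x y = b) (u w : V)
    (hu : K u) (hw : ¬ K w) : ¬ Relation.EqvGen (StepRel d M a b) u w := by
  have key : ∀ u w, Relation.EqvGen (StepRel d M a b) u w → (K u ↔ K w) := by
    intro u w huw
    induction huw with
    | rel u w h' =>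
      obtain ⟨h1, h2, h3, h4⟩ := h'
      constructor
      · intro hu; by_contra hw; have := h u h1 w h2 hu hw; tauto
      · intro hw; by_contra hu; have := h w h2 u h1 hw hu; rw [hd] at this; tauto
    | refl u => rfl
    | symm u w _ ih => exact ih.symm
    | trans u v w _ _ h1 h2 => exact h1.trans h2
  intro h'
  exact hw ((key u w h').1 hu)

theorem gallai_noneq {V α : Type} [DecidableEq V] (d : V → V → α) (hd : ∀ x y, d x y = d y x)
    (hr : ∀ x y z, x ≠ y → x ≠ z → y ≠ z → d x y = d x z ∨ d x y = d y z ∨ d x z = d y z)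
    (M : Finset V) : 2 ≤ M.card →
    ∃ a b, ∃ u ∈ M, ∃ w ∈ M, ¬ Relation.EqvGen (StepRel d M a b) u w := by
  induction M using Finset.induction_on with
  | empty => intro h; simp at h
  | insert v M hvM ih =>
    intro hcard
    rw [Finset.card_insert_of_notMem hvM] at hcard
    by_cases hM1 : M.card = 1
    · obtain ⟨u, rfl⟩ := Finset.card_eq_one.1 hM1
      have huv : u ≠ v := by intro e; subst e; simp at hvM
      refine ⟨d u v, d u v, u, by simp, v, by simp, ?_⟩
      refine cut_noneq d hd _ _ _ (fun x => x = u) ?_ u v rfl (Ne.symm huv)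
      intro x hx y hy h1 h2
      simp only [Finset.mem_insert, Finset.mem_singleton] at hx hy
      have : y = v := by tauto
      subst this; subst h1; exact Or.inl rfl
    obtain ⟨a, b, u, hu, w, hw, huw⟩ := ih (by omega)
    set E := Relation.EqvGen (StepRel d M a b) with hE
    have hvne : ∀ y ∈ M, v ≠ y := fun y hy e => hvM (e ▸ hy)
    have hconst := step_const d hd hr M a b
    have hcross := step_cross d M a b
    rw [← hE] at hconst hcross
    -- membership in the class forces membership in `M`
    have hEM : ∀ x y, E x y → x ∈ M → y ∈ M := by
      have key : ∀ x y, E x y → (x ∈ M ↔ y ∈ M) := by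
        intro x y h
        induction h with
        | rel x y h => exact ⟨fun _ => h.2.1, fun _ => h.1⟩
        | refl => rfl
        | symm _ _ _ ih => exact ih.symm
        | trans _ _ _ _ _ h1 h2 => exact h1.trans h2
      intro x y h hx; exact (key x y h).1 hx
    have hEs : ∀ x y, E x y → E y x := fun x y h => Relation.EqvGen.symm _ _ h
    have hEt : ∀ x y z, E x y → E y z → E x z := fun x y z h h' => Relation.EqvGen.trans _ _ _ h h'
    have hother : ∀ x ∈ M, ∃ z ∈ M, ¬ E x z := by
      intro x hx
      by_cases h : E x u
      · exact ⟨w, hw, fun h' => huw (hEt _ _ _ (hEs _ _ h) h')⟩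
      · exact ⟨u, hu, h⟩
    by_cases hA : ∃ x ∈ M, ∀ y, E x y → (d v y = a ∨ d v y = b)
    · obtain ⟨x, hx, hxy⟩ := hA
      refine ⟨a, b, x, by simp [hx], v, by simp, ?_⟩
      refine cut_noneq d hd _ _ _ (fun y => E x y) ?_ x v (Relation.EqvGen.refl _)
        (fun h => hvM (hEM _ _ h hx))
      intro y hy z hz h1 h2
      rcases Finset.mem_insert.1 hz with rfl | hz
      · rw [hd]; exact hxy y h1
      · exact hcross y z (hEM _ _ h1 hx) hz (fun h => h2 (hEt _ _ _ h1 h))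
    push Not at hA
    obtain ⟨y0, hy0E, hy0⟩ := hA u hu
    have hy0M := hEM _ _ hy0E hu
    -- two non-equivalent vertices with step-edges to `v` have the same color to `v`
    have hgr1 : ∀ y ∈ M, ∀ z ∈ M, ¬ E y z → (d v y ≠ a ∧ d v y ≠ b) → (d v z ≠ a ∧ d v z ≠ b) →
        d v y = d v z := by
      intro y hy z hz hyz h1 h2
      have hne : y ≠ z := fun e => hyz (e ▸ Relation.EqvGen.refl _)
      have hc := hcross y z hy hz hyz
      rcases hr v y z (hvne y hy) (hvne z hz) hne with h | h | h
      · exact h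
      · rw [h] at h1; tauto
      · rw [h] at h2; tauto
    have hgr : ∀ y ∈ M, (d v y ≠ a ∧ d v y ≠ b) → d v y = d v y0 := by
      intro y hy h1
      by_cases h : E y y0
      · obtain ⟨z, hz, hzE⟩ := hother y hy
        obtain ⟨z', hzz', hz'⟩ := hA z hz
        have hz'M := hEM _ _ hzz' hz
        have n1 : ¬ E y z' := fun h' => hzE (hEt _ _ _ h' (hEs _ _ hzz'))
        have n2 : ¬ E y0 z' := fun h' => n1 (hEt _ _ _ h h')
        rw [hgr1 y hy z' hz'M n1 h1 hz', hgr1 y0 hy0M z' hz'M n2 hy0 hz']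
      · exact hgr1 y hy y0 hy0M h h1 hy0
    by_cases hall : ∀ y ∈ M, d v y = d v y0
    · refine ⟨d v y0, d v y0, v, by simp, u, by simp [hu], ?_⟩
      refine cut_noneq d hd _ _ _ (fun x => x = v) ?_ v u rfl (Ne.symm (hvne u hu))
      intro x hx y hy h1 h2
      subst h1
      exact Or.inl (hall y ((Finset.mem_insert.1 hy).resolve_left h2))
    push Not at hall
    obtain ⟨x, hx, hxg⟩ := hall
    have hgz : ∀ z ∈ M, ∃ z' ∈ M, E z z' ∧ d v z' = d v y0 ∧ (d v z' ≠ a ∧ d v z' ≠ b) := by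
      intro z hz
      obtain ⟨z', h1, h2⟩ := hA z hz
      have := hEM _ _ h1 hz
      exact ⟨z', this, h1, hgr z' this h2, h2⟩
    have hKr : ∀ y z, E x y → z ∈ M → ¬ E x z → d y z = d v x := by
      intro y z hxy hz hxz
      obtain ⟨z', hz'M, hzz', hz'g, hz'n⟩ := hgz z hz
      have hxz' : ¬ E x z' := fun h => hxz (hEt _ _ _ h (hEs _ _ hzz'))
      have hne : x ≠ z' := fun e => hxz' (e ▸ Relation.EqvGen.refl _)
      have hc := hcross x z' hx hz'M hxz'
      have e1 : d x z' = d v x := by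
        rcases hr v x z' (hvne x hx) (hvne z' hz'M) hne with h | h | h
        · exact absurd (h.trans hz'g) hxg
        · exact h.symm
        · rw [h] at hz'n; tauto
      have e2 : d x z = d x z' := hconst x z z' hx hz hxz hzz'
      have e3 : d z x = d z y := hconst z x y hz hx (fun h => hxz (hEs _ _ h)) hxy
      rw [hd y z, ← e3, hd z x, e2, e1]
    refine ⟨d v x, d v y0, x, by simp [hx], v, by simp, ?_⟩
    refine cut_noneq d hd _ _ _ (fun y => E x y) ?_ x v (Relation.EqvGen.refl _)
        (fun h => hvM (hEM _ _ h hx))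
    intro y hy z hz h1 h2
    rcases Finset.mem_insert.1 hz with rfl | hz
    · have hyM := hEM _ _ h1 hx
      obtain ⟨q, hq, hqE⟩ := hother x hx
      obtain ⟨q', hq'M, hqq', hq'g, hq'n⟩ := hgz q hq
      have hxq' : ¬ E x q' := fun h => hqE (hEt _ _ _ h (hEs _ _ hqq'))
      have hyq' := hKr y q' h1 hq'M hxq'
      have hne : y ≠ q' := fun e => hxq' (e ▸ h1)
      rw [hd y]
      rcases hr z y q' (hvne y hyM) (hvne q' hq'M) hne with h | h | h
      · right; rw [h, hq'g]
      · left; rw [h, hyq']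
      · exfalso; apply hxg; rw [← hyq', ← h, hq'g]
    · exact Or.inl (hKr y z h1 hz h2)

theorem gallai_partition {V α : Type} [Fintype V] [DecidableEq V] (d : V → V → α)
    (hd : ∀ x y, d x y = d y x)
    (hr : ∀ x y z, x ≠ y → x ≠ z → y ≠ z → d x y = d x z ∨ d x y = d y z ∨ d x z = d y z)
    (M : Finset V) (hM : 2 ≤ M.card) :
    ∃ (a b : α) (p : V → ℕ), (∃ u ∈ M, ∃ w ∈ M, p u ≠ p w) ∧
      (∀ x ∈ M, ∀ y ∈ M, p x ≠ p y → d x y = a ∨ d x y = b) ∧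
      (∀ x ∈ M, ∀ y ∈ M, ∀ y' ∈ M, p x ≠ p y → p y = p y' → d x y = d x y') := by
  obtain ⟨a, b, u, hu, w, hw, huw⟩ := gallai_noneq d hd hr M hM
  let S := Relation.EqvGen.setoid (StepRel d M a b)
  let p : V → ℕ := fun v => (Fintype.equivFin V (Quotient.out (Quotient.mk S v))).val
  have hp : ∀ x y, p x = p y ↔ Relation.EqvGen (StepRel d M a b) x y := by
    intro x y
    simp only [p, Fin.val_inj, Equiv.apply_eq_iff_eq, Quotient.out_inj]
    exact Quotient.eq (r := S)
  refine ⟨a, b, p, ⟨u, hu, w, hw, fun h => huw ((hp _ _).1 h)⟩, ?_, ?_⟩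
  · intro x hx y hy h
    exact step_cross d M a b x y hx hy (fun h' => h ((hp _ _).2 h'))
  · intro x hx y hy y' hy' h h'
    exact step_const d hd hr M a b x y y' hx hy (fun h'' => h ((hp _ _).2 h'')) ((hp _ _).1 h')


theorem half_lemma {V α : Type} [DecidableEq V] (d : V → V → α) (hd : ∀ x y, d x y = d y x)
    (n : ℕ) (hn : 2 ≤ n) (b : α) (R : Finset V) (p : V → ℕ) (m : ℕ) (hm : n ≤ m)
    (hno : ¬ MonoCyc d n b)
    (hfib : ∀ t, (R.filter (fun v => p v = t)).card ≤ m)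
    (hb : ∀ x ∈ R, ∀ y ∈ R, p x ≠ p y → d x y = b) :
    R.card ≤ m + n ∨ (R.card ≤ 2 * m ∧ ∃ u1 ∈ R, ∃ u2 ∈ R, p u1 ≠ p u2 ∧
      n + 1 ≤ (R.filter (fun v => p v = p u1)).card ∧
      n + 1 ≤ (R.filter (fun v => p v = p u2)).card) := by
  by_cases hall : ∀ t, (R.filter (fun v => p v = t)).card ≤ n
  · left
    by_contra h
    exact hno (cyc_multi d hd n hn b R p (by omega) hall hb)
  push Not at hall
  obtain ⟨t, ht⟩ := hall
  obtain ⟨u1, hu1⟩ := Finset.card_pos.1 (show 0 < (R.filter (fun v => p v = t)).card by omega)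
  obtain ⟨hu1R, hu1t⟩ := Finset.mem_filter.1 hu1
  subst hu1t
  have hsum := Finset.card_filter_add_card_filter_not (s := R) (fun v => p v = p u1)
  have h1 := hfib (p u1)
  by_cases hsm : (R.filter (fun v => ¬ p v = p u1)).card ≤ n
  · left; omega
  right
  obtain ⟨u2, hu2⟩ := Finset.card_pos.1 (show 0 < (R.filter (fun v => ¬ p v = p u1)).card by omega)
  obtain ⟨hu2R, hu2n⟩ := Finset.mem_filter.1 hu2
  have heq : R.filter (fun v => ¬ p v = p u1) ⊆ R.filter (fun v => p v = p u2) := by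
    intro x hx
    obtain ⟨hxR, hxn⟩ := Finset.mem_filter.1 hx
    rw [Finset.mem_filter]
    refine ⟨hxR, ?_⟩
    by_contra hne
    apply hno
    refine cyc_bip d hd n hn b (R.filter (fun v => ¬ p v = p u1)) (R.filter (fun v => p v = p u1))
      (by omega) (by omega) ?_ ?_ x u2 hx hu2 (fun e => hne (e ▸ rfl)) (hb _ hxR _ hu2R hne)
    · rw [Finset.disjoint_left]
      intro z hz hz'
      exact (Finset.mem_filter.1 hz).2 (Finset.mem_filter.1 hz').2
    · intro y hy z hz
      obtain ⟨h1, h2⟩ := Finset.mem_filter.1 hy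
      obtain ⟨h3, h4⟩ := Finset.mem_filter.1 hz
      exact hb _ h1 _ h3 (by rw [h4]; exact h2)
  have h2 := Finset.card_le_card heq
  have h3 := hfib (p u2)
  exact ⟨by omega, u1, hu1R, u2, hu2R, Ne.symm hu2n, by omega, by omega⟩

/-- no pentagon-like blow-up -/
theorem no_penta {V α : Type} [DecidableEq V] (d : V → V → α) (hd : ∀ x y, d x y = d y x)
    (n : ℕ) (hn : 2 ≤ n) (a b : α) (A R1 R2 B1 B2 : Finset V)
    (hno : ∀ i, ¬ MonoCyc d n i)
    (hA : n + 1 ≤ A.card) (hR1 : n + 1 ≤ R1.card) (hR2 : n + 1 ≤ R2.card)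
    (hB1 : n + 1 ≤ B1.card) (hB2 : n + 1 ≤ B2.card)
    (dAR1 : Disjoint A R1) (dAR2 : Disjoint A R2) (dAB1 : Disjoint A B1) (dAB2 : Disjoint A B2)
    (dR : Disjoint R1 R2) (dB : Disjoint B1 B2) (d11 : Disjoint R1 B1) (d12 : Disjoint R1 B2)
    (d21 : Disjoint R2 B1) (d22 : Disjoint R2 B2)
    (hAR1 : ∀ x ∈ A, ∀ y ∈ R1, d x y = a) (hAR2 : ∀ x ∈ A, ∀ y ∈ R2, d x y = a)
    (hRR : ∀ x ∈ R1, ∀ y ∈ R2, d x y = b) (hBB : ∀ x ∈ B1, ∀ y ∈ B2, d x y = a)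
    (h11 : (∀ x ∈ R1, ∀ y ∈ B1, d x y = a) ∨ (∀ x ∈ R1, ∀ y ∈ B1, d x y = b))
    (h12 : (∀ x ∈ R1, ∀ y ∈ B2, d x y = a) ∨ (∀ x ∈ R1, ∀ y ∈ B2, d x y = b))
    (h21 : (∀ x ∈ R2, ∀ y ∈ B1, d x y = a) ∨ (∀ x ∈ R2, ∀ y ∈ B1, d x y = b))
    (h22 : (∀ x ∈ R2, ∀ y ∈ B2, d x y = a) ∨ (∀ x ∈ R2, ∀ y ∈ B2, d x y = b)) : False := by
  -- no monochromatic triangle of large sets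
  have tri : ∀ (i : α) (P Q T : Finset V), n + 1 ≤ P.card → n + 1 ≤ Q.card → n + 1 ≤ T.card →
      Disjoint P Q → Disjoint P T → Disjoint Q T → (∀ x ∈ P, ∀ y ∈ Q, d x y = i) →
      (∀ x ∈ P, ∀ y ∈ T, d x y = i) → (∀ x ∈ Q, ∀ y ∈ T, d x y = i) → False := by
    intro i P Q T hP hQ hT dPQ dPT dQT hPQ hPT hQT
    obtain ⟨u, hu⟩ := Finset.card_pos.1 (show 0 < Q.card by omega)
    obtain ⟨w, hw⟩ := Finset.card_pos.1 (show 0 < T.card by omega)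
    apply hno i
    refine cyc_bip d hd n hn i (Q ∪ T) P ?_ (by omega) ?_ ?_ u w (by simp [hu]) (by simp [hw]) ?_
      (hQT u hu w hw)
    · exact hQ.trans (Finset.card_le_card Finset.subset_union_left)
    · rw [Finset.disjoint_union_left]; exact ⟨dPQ.symm, dPT.symm⟩
    · intro x hx y hy
      rw [hd]
      rcases Finset.mem_union.1 hx with hx | hx
      · exact hPQ y hy x hx
      · exact hPT y hy x hx
    · intro e; exact Finset.disjoint_left.1 dQT hu (e ▸ hw)
  have sw : ∀ (i : α) (P Q : Finset V), (∀ x ∈ P, ∀ y ∈ Q, d x y = i) →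
      ∀ x ∈ Q, ∀ y ∈ P, d x y = i := by
    intro i P Q h x hx y hy; rw [hd]; exact h y hy x hx
  have pent : ∀ (Y U W Z : Finset V), n + 1 ≤ Y.card → n + 1 ≤ U.card → n + 1 ≤ W.card →
      n + 1 ≤ Z.card → Disjoint A Y → Disjoint A U → Disjoint A W → Disjoint A Z →
      Disjoint Y U → Disjoint Y W → Disjoint Y Z → Disjoint U W → Disjoint U Z → Disjoint W Z →
      (∀ x ∈ A, ∀ y ∈ Y, d x y = a) → (∀ x ∈ Y, ∀ y ∈ U, d x y = a) →
      (∀ x ∈ U, ∀ y ∈ W, d x y = a) → (∀ x ∈ W, ∀ y ∈ Z, d x y = a) →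
      (∀ x ∈ A, ∀ y ∈ Z, d x y = a) → False := by
    intro Y U W Z hY hU hW hZ e1 e2 e3 e4 e5 e6 e7 e8 e9 e10 f1 f2 f3 f4 f5
    obtain ⟨u, hu⟩ := Finset.card_pos.1 (show 0 < U.card by omega)
    obtain ⟨v, hv⟩ := Finset.card_pos.1 (show 0 < W.card by omega)
    obtain ⟨w, hw⟩ := Finset.card_pos.1 (show 0 < Z.card by omega)
    have dl : ∀ (P Q : Finset V), Disjoint P Q → ∀ x ∈ P, x ∉ Q := fun P Q h x hx =>
      Finset.disjoint_left.1 h hx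
    apply hno a
    refine cyc_penta d hd n hn a A Y (by omega) (by omega) e1 f1 u v w
      ⟨dl _ _ e2.symm u hu, dl _ _ e5.symm u hu⟩ ⟨dl _ _ e3.symm v hv, dl _ _ e6.symm v hv⟩
      ⟨dl _ _ e4.symm w hw, dl _ _ e7.symm w hw⟩ ?_ ?_ ?_ (fun y hy => f2 y hy u hu)
      (f3 u hu v hv) (f4 v hv w hw) (fun x hx => sw a _ _ f5 w hw x hx)
    · intro e; exact dl _ _ e8 u hu (e ▸ hv)
    · intro e; exact dl _ _ e9 u hu (e ▸ hw)
    · intro e; exact dl _ _ e10 v hv (e ▸ hw)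
  rcases h11 with h11 | h11
  · rcases h12 with h12 | h12
    · exact tri a R1 B1 B2 hR1 hB1 hB2 d11 d12 dB h11 h12 hBB
    · rcases h22 with h22 | h22
      · exact pent R1 B1 B2 R2 hR1 hB1 hB2 hR2 dAR1 dAB1 dAB2 dAR2 d11 d12 dR dB d21.symm d22.symm
          hAR1 h11 hBB (sw a _ _ h22) hAR2
      · exact tri b R1 R2 B2 hR1 hR2 hB2 dR d12 d22 hRR h12 h22
  · rcases h21 with h21 | h21
    · rcases h22 with h22 | h22
      · exact tri a R2 B1 B2 hR2 hB1 hB2 d21 d22 dB h21 h22 hBB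
      · rcases h12 with h12 | h12
        · exact pent R2 B1 B2 R1 hR2 hB1 hB2 hR1 dAR2 dAB1 dAB2 dAR1 d21 d22 dR.symm dB d11.symm
            d12.symm hAR2 h21 hBB (sw a _ _ h12) hAR1
        · exact tri b R1 R2 B2 hR1 hR2 hB2 dR d12 d22 hRR h12 h22
    · exact tri b R1 R2 B1 hR1 hR2 hB1 dR d11 d21 hRR h11 h21

theorem main_bound {V α : Type} [Fintype V] [DecidableEq V] [DecidableEq α] (d : V → V → α)
    (hd : ∀ x y, d x y = d y x)
    (hr : ∀ x y z, x ≠ y → x ≠ z → y ≠ z → d x y = d x z ∨ d x y = d y z ∨ d x z = d y z)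
    (n : ℕ) (hn : 2 ≤ n) (hno : ∀ i, ¬ MonoCyc d n i) :
    ∀ (s : ℕ) (S : Finset V) (C : Finset α), C.card = s →
      (∀ x ∈ S, ∀ y ∈ S, x ≠ y → d x y ∈ C) → S.card + (s + 3) * n < 8 * 2 ^ s * n := by
  intro s
  induction s using Nat.strong_induction_on with
  | _ s ih =>
  intro S C hCs hSC
  by_contra hbig
  push Not at hbig
  -- at most one color
  by_cases hs1 : s ≤ 1
  · have hS : 2 * n + 1 ≤ S.card := by
      interval_cases s <;> omega
    obtain ⟨e, he, hei⟩ := exists_enum S (2 * n + 1) hS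
      (Finset.card_pos.1 (show 0 < S.card by omega)).choose
    have hC1 : ∀ i ∈ C, ∀ j ∈ C, i = j := by
      rw [← Finset.card_le_one]; omega
    have hcc : ∀ x ∈ S, ∀ y ∈ S, x ≠ y → d x y = d (e 0) (e 1) := by
      intro x hx y hy hxy
      refine hC1 _ (hSC x hx y hy hxy) _ (hSC _ (he _ (by omega)) _ (he _ (by omega)) ?_)
      intro h; have := hei _ _ (by omega) (by omega) h; omega
    refine hno (d (e 0) (e 1)) ⟨e, fun s t hs ht h => hei s t hs ht h, ?_, ?_⟩
    · intro j hj
      refine hcc _ (he _ (by omega)) _ (he _ (by omega)) ?_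
      intro h; have := hei _ _ (by omega) (by omega) h; omega
    · refine hcc _ (he _ (by omega)) _ (he _ (by omega)) ?_
      intro h; have := hei _ _ (by omega) (by omega) h; omega
  obtain ⟨r, rfl⟩ : ∃ r, s = r + 2 := ⟨s - 2, by omega⟩
  have hpow1 : (2 : ℕ) ^ (r + 2) = 4 * 2 ^ r := by ring
  have hpow2 : (2 : ℕ) ^ (r + 1) = 2 * 2 ^ r := by ring
  -- minimal module with few outside vertices of each color
  let D : Finset V → α → Finset V := fun M i => (S \ M).filter (fun v => ∀ x ∈ M, d v x = i)
  let Good : Finset V → Prop := fun M => M ⊆ S ∧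
    (∀ v ∈ S \ M, ∀ x ∈ M, ∀ y ∈ M, d v x = d v y) ∧ ∀ i, (D M i).card < n
  have hex : ∃ m, ∃ M, Good M ∧ M.card = m := by
    refine ⟨S.card, S, ⟨subset_rfl, by simp, ?_⟩, rfl⟩
    intro i; simp [D]; omega
  classical
  obtain ⟨M, hMgood, hMmin⟩ : ∃ M, Good M ∧ ∀ M', Good M' → M.card ≤ M'.card := by
    obtain ⟨M, h1, h2⟩ := Nat.find_spec hex
    refine ⟨M, h1, fun M' h' => ?_⟩
    rw [h2]; exact Nat.find_min' hex ⟨M', h', rfl⟩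
  obtain ⟨hMS, hMmod, hMD⟩ := hMgood
  have h2r : 1 ≤ 2 ^ r := Nat.one_le_two_pow
  have hr2 : r + 1 ≤ 2 ^ r := Nat.lt_two_pow_self
  have hSM : S.card ≤ M.card + (r + 2) * n := by
    by_cases hMe : M = ∅
    · exfalso
      subst hMe
      have hC0 : C.Nonempty := Finset.card_pos.1 (by omega)
      obtain ⟨i, -⟩ := hC0
      have h1 := hMD i
      have : D ∅ i = S := by simp [D]
      rw [this] at h1
      have h3 : (r + 1) * n ≤ 2 ^ r * n := Nat.mul_le_mul_right n hr2
      rw [hpow1] at hbig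
      nlinarith
    obtain ⟨x0, hx0⟩ := Finset.nonempty_iff_ne_empty.2 hMe
    have hsub : S \ M ⊆ C.biUnion (fun i => D M i) := by
      intro v hv
      rw [Finset.mem_biUnion]
      have hv' := Finset.mem_sdiff.1 hv
      refine ⟨d v x0, hSC v hv'.1 x0 (hMS hx0) (fun e => hv'.2 (e ▸ hx0)), ?_⟩
      simp only [D, Finset.mem_filter]
      exact ⟨hv, fun x hx => hMmod v hv x hx x0 hx0⟩
    have h1 := Finset.card_le_card hsub
    have h2 := Finset.card_biUnion_le_card_mul C (fun i => D M i) n (fun i _ => (hMD i).le)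
    have h3 := Finset.card_sdiff_add_card_eq_card hMS
    rw [hCs] at h2
    omega
  have hMbig : 8 * 2 ^ (r + 2) * n ≤ M.card + (2 * r + 7) * n := by nlinarith
  have hM21 : 21 * n ≤ M.card := by
    rw [hpow1] at hMbig
    have h3 : (r + 1) * n ≤ 2 ^ r * n := Nat.mul_le_mul_right n hr2
    nlinarith
  obtain ⟨a, b, p, ⟨u0, hu0, w0, hw0, huw0⟩, hab, hcon⟩ := gallai_partition d hd hr M (by omega)
  -- the largest part
  obtain ⟨a0, ha0, hmax⟩ := Finset.exists_max_image M
    (fun v => (M.filter (fun x => p x = p v)).card) ⟨u0, hu0⟩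
  set A := M.filter (fun x => p x = p a0) with hA
  have hfibM : ∀ t, (M.filter (fun v => p v = t)).card ≤ A.card := by
    intro t
    by_cases he : M.filter (fun v => p v = t) = ∅
    · rw [he]; simp
    · obtain ⟨v, hv⟩ := Finset.nonempty_iff_ne_empty.2 he
      obtain ⟨h1, rfl⟩ := Finset.mem_filter.1 hv
      exact hmax v h1
  by_cases hAn : A.card ≤ n
  · rcases small_case d hd n hn M p a b hM21 (fun t => (hfibM t).trans hAn) hab with h | h
    · exact hno _ h
    · exact hno _ h
  push Not at hAn
  have hAM : A ⊆ M := Finset.filter_subset _ _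
  have ha0A : a0 ∈ A := by simp [hA, ha0]
  have hpA : ∀ x ∈ A, p x = p a0 := fun x hx => (Finset.mem_filter.1 hx).2
  -- constancy of colors between parts
  have hcon2 : ∀ x ∈ M, ∀ x' ∈ M, ∀ y ∈ M, ∀ y' ∈ M, p x = p x' → p y = p y' → p x ≠ p y →
      d x y = d x' y' := by
    intro x hx x' hx' y hy y' hy' h1 h2 h3
    rw [hcon x hx y hy y' hy' h3 h2, hd x y', hd x' y']
    exact hcon y' hy' x hx x' hx' (by rw [← h2]; exact h3.symm) h1
  -- some color is missing in `A`
  have hAlt : A.card < M.card := by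
    apply Finset.card_lt_card
    refine Finset.ssubset_iff_subset_ne.2 ⟨hAM, fun e => ?_⟩
    rw [← e] at hu0 hw0
    exact huw0 ((hpA _ hu0).trans (hpA _ hw0).symm)
  have hAmod : ∀ v ∈ S \ A, ∀ x ∈ A, ∀ y ∈ A, d v x = d v y := by
    intro v hv x hx y hy
    obtain ⟨hvS, hvA⟩ := Finset.mem_sdiff.1 hv
    by_cases hvM : v ∈ M
    · refine hcon v hvM x (hAM hx) y (hAM hy) ?_ ((hpA x hx).trans (hpA y hy).symm)
      intro e
      exact hvA (Finset.mem_filter.2 ⟨hvM, e.trans (hpA x hx)⟩)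
    · exact hMmod v (Finset.mem_sdiff.2 ⟨hvS, hvM⟩) x (hAM hx) y (hAM hy)
  have hAi : ∃ i, n ≤ (D A i).card := by
    by_contra hcc
    push Not at hcc
    have := hMmin A ⟨hAM.trans hMS, hAmod, hcc⟩
    omega
  obtain ⟨i, hi⟩ := hAi
  have hDmem : ∀ v ∈ D A i, v ∈ S ∧ v ∉ A ∧ ∀ x ∈ A, d v x = i := by
    intro v hv
    simp only [D, Finset.mem_filter, Finset.mem_sdiff] at hv
    exact ⟨hv.1.1, hv.1.2, hv.2⟩
  have hiC : i ∈ C := by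
    obtain ⟨v, hv⟩ := Finset.card_pos.1 (show 0 < (D A i).card by omega)
    obtain ⟨h1, h2, h3⟩ := hDmem v hv
    rw [← h3 a0 ha0A]
    exact hSC v h1 a0 (hMS ha0) (fun e => h2 (e ▸ ha0A))
  -- a subset missing a color of `C`
  have hlose : ∀ (T : Finset V) (j : α), T ⊆ S → j ∈ C → (∀ x ∈ T, ∀ y ∈ T, x ≠ y → d x y ≠ j) →
      T.card + (r + 4) * n < 8 * 2 ^ (r + 1) * n := by
    intro T j hTS hj hT
    have := ih (r + 1) (by omega) T (C.erase j) (by rw [Finset.card_erase_of_mem hj]; omega) (by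
      intro x hx y hy hxy
      exact Finset.mem_erase.2 ⟨hT x hx y hy hxy, hSC x (hTS hx) y (hTS hy) hxy⟩)
    exact this
  have hA1 : A.card + (r + 4) * n < 8 * 2 ^ (r + 1) * n := by
    refine hlose A i (hAM.trans hMS) hiC ?_
    intro x hx y hy hxy hxyi
    refine hno i (cyc_bip d hd n hn i A (D A i) (by omega) hi ?_ ?_ x y hx hy hxy hxyi)
    · rw [Finset.disjoint_left]; intro z hz hz'; exact (hDmem z hz').2.1 hz
    · intro z hz v hv; rw [hd]; exact (hDmem v hv).2.2 z hz
  set R := M.filter (fun x => p x ≠ p a0 ∧ d a0 x = a) with hR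
  set B := M.filter (fun x => p x ≠ p a0 ∧ d a0 x ≠ a) with hB
  have hRM : R ⊆ M := Finset.filter_subset _ _
  have hBM : B ⊆ M := Finset.filter_subset _ _
  have hsum : M.card ≤ A.card + R.card + B.card := by
    have hsub : M ⊆ A ∪ R ∪ B := by
      intro x hx
      simp only [hA, hR, hB, Finset.mem_union, Finset.mem_filter]
      tauto
    have h1 := Finset.card_le_card hsub
    have h2 := Finset.card_union_le (A ∪ R) B
    have h3 := Finset.card_union_le A R
    omega
  have hRp : ∀ x ∈ R, p x ≠ p a0 := fun x hx => (Finset.mem_filter.1 hx).2.1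
  have hBp : ∀ x ∈ B, p x ≠ p a0 := fun x hx => (Finset.mem_filter.1 hx).2.1
  have hAR : ∀ x ∈ A, ∀ y ∈ R, d x y = a := by
    intro x hx y hy
    rw [← (Finset.mem_filter.1 hy).2.2]
    exact hcon2 x (hAM hx) a0 ha0 y (hRM hy) y (hRM hy) (hpA x hx) rfl
      (by rw [hpA x hx]; exact (hRp y hy).symm)
  have hAB : ∀ x ∈ A, ∀ y ∈ B, d x y = b ∧ b ≠ a := by
    intro x hx y hy
    have h1 := (Finset.mem_filter.1 hy).2.2
    have h2 := (hab a0 ha0 y (hBM hy) (hBp y hy).symm).resolve_left h1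
    rw [← h2]
    exact ⟨hcon2 x (hAM hx) a0 ha0 y (hBM hy) y (hBM hy) (hpA x hx) rfl
      (by rw [hpA x hx]; exact (hBp y hy).symm), h1⟩
  have hdAR : Disjoint A R := by
    rw [Finset.disjoint_left]; intro x hx hy; exact hRp x hy (hpA x hx)
  have hdAB : Disjoint A B := by
    rw [Finset.disjoint_left]; intro x hx hy; exact hBp x hy (hpA x hx)
  have hdRB : Disjoint R B := by
    rw [Finset.disjoint_left]; intro x hx hy
    exact (Finset.mem_filter.1 hy).2.2 (Finset.mem_filter.1 hx).2.2
  have hAdA : ∀ x ∈ A, ∀ y ∈ A, x ≠ y → n ≤ R.card → d x y ≠ a := by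
    intro x hx y hy hxy hRn h
    exact hno a (cyc_bip d hd n hn a A R (by omega) hRn hdAR hAR x y hx hy hxy h)
  have hAdB : ∀ x ∈ A, ∀ y ∈ A, x ≠ y → n ≤ B.card → d x y ≠ b := by
    intro x hx y hy hxy hRn h
    exact hno b (cyc_bip d hd n hn b A B (by omega) hRn hdAB (fun x hx y hy => (hAB x hx y hy).1)
      x y hx hy hxy h)
  have hRno : n + 1 ≤ R.card → ∀ x ∈ R, ∀ y ∈ R, x ≠ y → d x y ≠ a := by
    intro hRn x hx y hy hxy h
    exact hno a (cyc_bip d hd n hn a R A (by omega) (by omega) hdAR.symm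
      (fun x hx y hy => by rw [hd]; exact hAR y hy x hx) x y hx hy hxy h)
  have hBno : n + 1 ≤ B.card → ∀ x ∈ B, ∀ y ∈ B, x ≠ y → d x y ≠ b := by
    intro hRn x hx y hy hxy h
    exact hno b (cyc_bip d hd n hn b B A (by omega) (by omega) hdAB.symm
      (fun x hx y hy => by rw [hd]; exact (hAB y hy x hx).1) x y hx hy hxy h)
  have haC : n + 1 ≤ R.card → a ∈ C := by
    intro h
    obtain ⟨v, hv⟩ := Finset.card_pos.1 (show 0 < R.card by omega)
    rw [← hAR a0 ha0A v hv]
    exact hSC a0 (hMS ha0) v (hMS (hRM hv)) (fun e => hRp v hv (e ▸ rfl))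
  have hbC : n + 1 ≤ B.card → b ∈ C := by
    intro h
    obtain ⟨v, hv⟩ := Finset.card_pos.1 (show 0 < B.card by omega)
    rw [← (hAB a0 ha0A v hv).1]
    exact hSC a0 (hMS ha0) v (hMS (hBM hv)) (fun e => hBp v hv (e ▸ rfl))
  have hR1 : n + 1 ≤ R.card → R.card + (r + 4) * n < 8 * 2 ^ (r + 1) * n := fun h =>
    hlose R a (hRM.trans hMS) (haC h) (hRno h)
  have hB1 : n + 1 ≤ B.card → B.card + (r + 4) * n < 8 * 2 ^ (r + 1) * n := fun h =>
    hlose B b (hBM.trans hMS) (hbC h) (hBno h)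
  have hrn : (r + 1) * n ≤ 2 ^ r * n := Nat.mul_le_mul_right n hr2
  rw [hpow1] at hMbig hbig
  rw [hpow2] at hA1 hR1 hB1
  by_cases hBsm : B.card ≤ n
  · by_cases hRsm : R.card ≤ n
    · nlinarith
    · have := hR1 (by omega)
      nlinarith
  by_cases hRsm : R.card ≤ n
  · have := hB1 (by omega)
    nlinarith
  have hRbig : n + 1 ≤ R.card := by omega
  have hBbig : n + 1 ≤ B.card := by omega
  have hba : b ≠ a := by
    obtain ⟨v, hv⟩ := Finset.card_pos.1 (show 0 < B.card by omega)
    exact (hAB a0 ha0A v hv).2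
  have hA2 : A.card + (r + 3) * n < 8 * 2 ^ r * n := by
    refine ih r (by omega) A ((C.erase a).erase b) ?_ ?_
    · rw [Finset.card_erase_of_mem (Finset.mem_erase.2 ⟨hba, hbC hBbig⟩),
        Finset.card_erase_of_mem (haC hRbig)]; omega
    · intro x hx y hy hxy
      exact Finset.mem_erase.2 ⟨hAdB x hx y hy hxy (by omega), Finset.mem_erase.2
        ⟨hAdA x hx y hy hxy (by omega), hSC x (hMS (hAM hx)) y (hMS (hAM hy)) hxy⟩⟩
  have hne : ∀ x y, p x ≠ p y → x ≠ y := fun x y h e => h (e ▸ rfl)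
  have hRb : ∀ x ∈ R, ∀ y ∈ R, p x ≠ p y → d x y = b := fun x hx y hy hxy =>
    (hab x (hRM hx) y (hRM hy) hxy).resolve_left (hRno hRbig x hx y hy (hne _ _ hxy))
  have hBa : ∀ x ∈ B, ∀ y ∈ B, p x ≠ p y → d x y = a := fun x hx y hy hxy =>
    (hab x (hBM hx) y (hBM hy) hxy).resolve_right (hBno hBbig x hx y hy (hne _ _ hxy))
  have hfib : ∀ Z ⊆ M, ∀ t, (Z.filter (fun v => p v = t)).card ≤ A.card := fun Z hZ t =>
    (Finset.card_le_card (Finset.filter_subset_filter _ hZ)).trans (hfibM t)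
  have hRh := half_lemma d hd n hn b R p A.card (by omega) (hno b) (hfib R hRM) hRb
  have hBh := half_lemma d hd n hn a B p A.card (by omega) (hno a) (hfib B hBM) hBa
  rcases hRh with hRh | ⟨hRh, u1, hu1, u2, hu2, hu12, hc1, hc2⟩
  · have : B.card ≤ 2 * A.card := by
      rcases hBh with h | ⟨h, -⟩ <;> omega
    nlinarith
  rcases hBh with hBh | ⟨hBh, v1, hv1, v2, hv2, hv12, hc3, hc4⟩
  · nlinarith
  have hfd : ∀ (Z Z' : Finset V) (s t : ℕ), s ≠ t →
      Disjoint (Z.filter (fun v => p v = s)) (Z'.filter (fun v => p v = t)) := by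
    intro Z Z' s t hst
    rw [Finset.disjoint_left]
    intro x hx hy
    exact hst ((Finset.mem_filter.1 hx).2.symm.trans (Finset.mem_filter.1 hy).2)
  have hfs : ∀ (Z : Finset V) (t : ℕ), Z.filter (fun v => p v = t) ⊆ Z := fun Z t =>
    Finset.filter_subset _ _
  have hdRB' : ∀ s t, Disjoint (R.filter (fun v => p v = s)) (B.filter (fun v => p v = t)) :=
    fun s t => hdRB.mono (hfs R s) (hfs B t)
  have hRBp : ∀ x ∈ R, ∀ y ∈ B, p x ≠ p y := by
    intro x hx y hy e
    have h1 := hcon a0 ha0 x (hRM hx) y (hBM hy) (hRp x hx).symm e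
    exact (Finset.mem_filter.1 hy).2.2 (h1.symm.trans (Finset.mem_filter.1 hx).2.2)
  have hRBc : ∀ u ∈ R, ∀ v ∈ B,
      (∀ x ∈ R.filter (fun z => p z = p u), ∀ y ∈ B.filter (fun z => p z = p v), d x y = a) ∨
      (∀ x ∈ R.filter (fun z => p z = p u), ∀ y ∈ B.filter (fun z => p z = p v), d x y = b) := by
    intro u hu v hv
    have hc : ∀ x ∈ R.filter (fun z => p z = p u), ∀ y ∈ B.filter (fun z => p z = p v),
        d x y = d u v := by
      intro x hx y hy
      obtain ⟨h1, h2⟩ := Finset.mem_filter.1 hx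
      obtain ⟨h3, h4⟩ := Finset.mem_filter.1 hy
      exact hcon2 x (hRM h1) u (hRM hu) y (hBM h3) v (hBM hv) h2 h4 (hRBp x h1 y h3)
    rcases hab u (hRM hu) v (hBM hv) (hRBp u hu v hv) with h | h
    · left; intro x hx y hy; rw [hc x hx y hy, h]
    · right; intro x hx y hy; rw [hc x hx y hy, h]
  refine no_penta d hd n hn a b A _ _ _ _ hno (by omega) hc1 hc2 hc3 hc4
    (hdAR.mono_right (hfs _ _)) (hdAR.mono_right (hfs _ _)) (hdAB.mono_right (hfs _ _))
    (hdAB.mono_right (hfs _ _)) (hfd _ _ _ _ hu12) (hfd _ _ _ _ hv12) (hdRB' _ _) (hdRB' _ _)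
    (hdRB' _ _) (hdRB' _ _) (fun x hx y hy => hAR x hx y (hfs _ _ hy))
    (fun x hx y hy => hAR x hx y (hfs _ _ hy)) ?_ ?_ (hRBc _ hu1 _ hv1) (hRBc _ hu1 _ hv2)
    (hRBc _ hu2 _ hv1) (hRBc _ hu2 _ hv2)
  · intro x hx y hy
    obtain ⟨h1, h2⟩ := Finset.mem_filter.1 hx
    obtain ⟨h3, h4⟩ := Finset.mem_filter.1 hy
    exact hRb x h1 y h3 (by rw [h2, h4]; exact hu12)
  · intro x hx y hy
    obtain ⟨h1, h2⟩ := Finset.mem_filter.1 hx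
    obtain ⟨h3, h4⟩ := Finset.mem_filter.1 hy
    exact hBa x h1 y h3 (by rw [h2, h4]; exact hv12)

theorem monoCyc_copy {V α : Type} (c : Sym2 V → α) (n : ℕ) (i : α)
    (h : MonoCyc (fun x y => c s(x, y)) n i) : HasMonoCopyIn c (cycleGraph (2 * n + 1)) i := by
  obtain ⟨g, hi, hs, hc⟩ := h
  refine ⟨⟨fun u => g u.val, fun u v huv => Fin.ext (hi _ _ u.isLt v.isLt huv)⟩, ?_⟩
  have key : ∀ u v : Fin (2 * n + 1), (u - v).val = 1 → c s(g v.val, g u.val) = i := by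
    intro u v huv
    have hu := u.isLt
    have hv := v.isLt
    rw [Fin.val_sub] at huv
    by_cases hle : v.val ≤ u.val
    · have e : 2 * n + 1 - v.val + u.val = (u.val - v.val) + (2 * n + 1) := by omega
      rw [e, Nat.add_mod_right, Nat.mod_eq_of_lt (by omega)] at huv
      have : u.val = v.val + 1 := by omega
      rw [this]; exact hs _ (by omega)
    · rw [Nat.mod_eq_of_lt (by omega)] at huv
      have h1 : u.val = 0 := by omega
      have h2 : v.val = 2 * n := by omega
      rw [h1, h2]; exact hc
  intro u v huv
  rcases cycleGraph_adj'.1 huv with h | h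
  · rw [Sym2.eq_swap]; exact key u v h
  · exact key v u h

theorem gr_main (n k N : ℕ) (hn : 2 ≤ n) (hN : 8 * 2 ^ k * n ≤ N + (k + 3) * n)
    (c : Sym2 (Fin N) → Fin k) :
    HasRainbowTriangle c ∨ HasMonoCopy c (cycleGraph (2 * n + 1)) := by
  by_contra hcon
  push Not at hcon
  obtain ⟨h1, h2⟩ := hcon
  have := main_bound (fun x y => c s(x, y)) (fun x y => by rw [Sym2.eq_swap]) (by
      intro x y z hxy hxz hyz
      by_contra hc
      push Not at hc
      exact h1 ⟨x, y, z, hxy, hxz, hyz, hc⟩) n hn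
    (fun i hi => h2 ⟨i, monoCyc_copy c n i hi⟩) k Finset.univ Finset.univ (by simp) (by simp)
  simp only [Finset.card_univ, Fintype.card_fin] at this
  omega

theorem gallai_ramsey_odd_cycles_log_upper (n k : ℕ) (hn : 2 ≤ n) (hk : 1 ≤ k) :
    (gr k (cycleGraph (2 * n + 1)) : ℝ) ≤ (2 ^ (k + 3) - 3) * n * Real.logb 2 n ∧
    (∀ N : ℕ, ((2 ^ (k + 3) - 3 : ℝ) * n * Real.logb 2 n ≤ N) →
      ∀ c : Sym2 (Fin N) → Fin k,
        HasRainbowTriangle c ∨ HasMonoCopy c (cycleGraph (2 * n + 1))) := by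
  have hn' : (2 : ℝ) ≤ n := by exact_mod_cast hn
  have hlog : 1 ≤ Real.logb 2 n := by
    rw [Real.le_logb_iff_rpow_le (by norm_num) (by linarith)]
    simpa using hn'
  have hpk : (1 : ℝ) ≤ 2 ^ k := one_le_pow₀ (by norm_num)
  have hpow : (2 : ℝ) ^ (k + 3) = 8 * 2 ^ k := by ring
  have hbd : (8 * 2 ^ k - 3 : ℝ) * n ≤ (2 ^ (k + 3) - 3) * n * Real.logb 2 n := by
    rw [hpow]
    refine le_mul_of_one_le_right ?_ hlog
    apply mul_nonneg <;> linarith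
  have hkk : k < 2 ^ k := Nat.lt_two_pow_self
  have h8 : 3 ≤ 8 * 2 ^ k := by omega
  constructor
  · refine le_trans ?_ hbd
    have h1 : gr k (cycleGraph (2 * n + 1)) ≤ (8 * 2 ^ k - 3) * n := by
      apply Nat.sInf_le
      intro N hN c
      refine gr_main n k N hn ?_ c
      have h2 : (8 * 2 ^ k - 3) * n + 3 * n = 8 * 2 ^ k * n := by
        rw [← Nat.add_mul]; congr 1; omega
      nlinarith
    have h2 : (gr k (cycleGraph (2 * n + 1)) : ℝ) ≤ (((8 * 2 ^ k - 3) * n : ℕ) : ℝ) := by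
      exact_mod_cast h1
    refine h2.trans (le_of_eq ?_)
    rw [Nat.cast_mul, Nat.cast_sub h8]
    push_cast
    ring
  · intro N hN c
    refine gr_main n k N hn ?_ c
    have h1 := hbd.trans hN
    have h2 : (8 * 2 ^ k * n : ℝ) ≤ N + 3 * n := by linarith
    have h3 : 8 * 2 ^ k * n ≤ N + 3 * n := by exact_mod_cast h2
    nlinarith
end

section
/- For every integer k ≥ 2, the k-color Gallai-Ramsey number of the cycle on five vertices satisfies gr_k(K_3 : C_5) = 2^{k+1} + 1. -/
open SimpleGraph

namespace GR

variable {V α : Type*}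

/-- Symmetric coloring without rainbow triangle. -/
structure Gal (c : V → V → α) : Prop where
  symm : ∀ x y, c x y = c y x
  tri : ∀ x y z, x ≠ y → x ≠ z → y ≠ z → c x y = c x z ∨ c x y = c y z ∨ c x z = c y z

open Classical in
lemma min_module {c : V → V → α} (h : Gal c) (Q : α → Prop) (S X : Finset V) (s : V)
    (hXS : X ⊂ S) (hX : X.Nonempty) (hQ : ∀ x ∈ X, ∀ y ∈ S, y ∉ X → Q (c x y)) (hs : s ∈ S) :
    ∃ M : Finset V, M ⊂ S ∧ s ∈ M ∧ (∀ x ∈ M, ∀ y ∈ S, y ∉ M → Q (c x y)) ∧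
      (∀ z ∈ S, z ∉ M → ∀ x ∈ M, ∀ y ∈ M, c z x = c z y) := by
  let F := S.powerset.filter fun M => M ≠ S ∧ s ∈ M ∧ (∀ x ∈ M, ∀ y ∈ S, y ∉ M → Q (c x y))
  have hF : ∀ M, M ∈ F ↔ (M ⊆ S ∧ M ≠ S ∧ s ∈ M ∧ (∀ x ∈ M, ∀ y ∈ S, y ∉ M → Q (c x y))) := by
    intro M; simp [F]
  have hne : F.Nonempty := by
    by_cases hsX : s ∈ X
    · exact ⟨X, (hF X).2 ⟨hXS.1, hXS.ne, hsX, hQ⟩⟩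
    · refine ⟨S \ X, (hF _).2 ⟨Finset.sdiff_subset, ?_, by simp [hs, hsX], ?_⟩⟩
      · obtain ⟨x, hx⟩ := hX
        intro he
        have : x ∈ S \ X := by rw [he]; exact hXS.1 hx
        simp_all
      · intro x hx y hy hyX
        simp only [Finset.mem_sdiff, not_and, not_not] at hx hyX
        rw [h.symm]
        exact hQ y (hyX hy) x hx.1 hx.2
  obtain ⟨M, hM, hmin⟩ := Finset.exists_min_image F Finset.card hne
  obtain ⟨h1, h2, h3, h4⟩ := (hF M).1 hM
  refine ⟨M, Finset.ssubset_iff_subset_ne.2 ⟨h1, h2⟩, h3, h4, ?_⟩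
  intro z hz hzM
  have key : ∀ x ∈ M, c z x = c z s := by
    by_contra! hcon
    obtain ⟨x, hx, hxs⟩ := hcon
    let M' := M.filter fun x => c z x = c z s
    have hM' : M' ⊂ M := by
      refine Finset.ssubset_iff_subset_ne.2 ⟨Finset.filter_subset _ _, ?_⟩
      intro he
      have : x ∈ M' := he ▸ hx
      simp [M'] at this
      exact hxs this.2
    have hin : M' ∈ F := by
      refine (hF M').2 ⟨hM'.1.trans h1, ?_, by simp [M', h3], ?_⟩
      · intro he
        exact h2 (Finset.Subset.antisymm h1 (he ▸ hM'.1))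
      · intro u hu y hy hyM'
        have hu' : u ∈ M ∧ c z u = c z s := by simpa [M'] using hu
        by_cases hyM : y ∈ M
        · have hy' : c z y ≠ c z s := by
            intro hh; exact hyM' (by simp [M', hyM, hh])
          have q1 := h4 u hu'.1 z hz hzM
          have q2 := h4 y hyM z hz hzM
          have e1 : z ≠ u := by rintro rfl; exact hzM hu'.1
          have e2 : z ≠ y := by rintro rfl; exact hzM hyM
          have e3 : u ≠ y := by rintro rfl; exact hy' hu'.2
          have t := h.tri z u y e1 e2 e3
          rw [h.symm] at q1 q2
          rcases t with t | t | t
          · exact absurd (t.symm.trans hu'.2) hy'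
          · rwa [← t]
          · rwa [← t]
        · exact h4 u hu'.1 y hy hyM
    exact absurd (hmin M' hin) (not_le.2 (Finset.card_lt_card hM'))
  intro x hx y hy
  rw [key x hx, key y hy]

/-- There is a cut of `S` whose crossing edges all satisfy `Q`. -/
def Cut (c : V → V → α) (S : Finset V) (Q : α → Prop) : Prop :=
  ∃ X : Finset V, X ⊂ S ∧ X.Nonempty ∧ ∀ x ∈ X, ∀ y ∈ S, y ∉ X → Q (c x y)

open Classical in
lemma three_aux {c : V → V → α} (h : Gal c) {a b d : α} (hab : a ≠ b) (had : a ≠ d) (hbd : b ≠ d)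
    (S : Finset V) (x : V) (hxS : x ∉ S)
    (hcut : Cut c S (· ≠ a)) (ha : ¬ Cut c (insert x S) (· ≠ a))
    (hb : ¬ Cut c (insert x S) (· ≠ b)) (hd : ¬ Cut c (insert x S) (· ≠ d)) : False := by
  obtain ⟨X, hXS, hX, hQ⟩ := hcut
  have hSne : S.Nonempty := hX.mono hXS.1
  have edge : ∀ e, ¬ Cut c (insert x S) (· ≠ e) → ∃ y ∈ S, c x y = e := by
    intro e he
    by_contra! hcon
    refine he ⟨{x}, ?_, by simp, ?_⟩
    · obtain ⟨s, hs⟩ := hSne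
      refine Finset.ssubset_iff_subset_ne.2 ⟨by simp, ?_⟩
      intro hh
      have : s ∈ ({x} : Finset V) := by rw [hh]; simp [hs]
      simp at this; subst this; exact hxS hs
    · intro u hu y hy hyu
      simp at hu hyu hy
      subst hu
      exact hcon y (by tauto)
  obtain ⟨y, hy, hxy⟩ := edge b hb
  obtain ⟨z, hz, hxz⟩ := edge d hd
  -- closed sets and edges from x
  have out : ∀ M ⊂ S, M.Nonempty → (∀ u ∈ M, ∀ v ∈ S, v ∉ M → c u v ≠ a) → 
      ∃ w ∈ M, c x w = a := by
    intro M hM hMn hMQ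
    by_contra! hcon
    refine ha ⟨M, ?_, hMn, ?_⟩
    · exact lt_of_lt_of_le hM (Finset.subset_insert _ _)
    · intro u hu v hv hvM
      rcases Finset.mem_insert.1 hv with rfl | hv
      · rw [h.symm]; exact hcon u hu
      · exact hMQ u hu v hv hvM
  have out' : ∀ M ⊂ S, M.Nonempty → (∀ u ∈ M, ∀ v ∈ S, v ∉ M → c u v ≠ a) → 
      ∃ w ∈ S, w ∉ M ∧ c x w = a := by
    intro M hM hMn hMQ
    obtain ⟨w, hw, hw'⟩ := out (S \ M) (Finset.sdiff_ssubset hM.1 hMn)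
      (Finset.sdiff_nonempty.2 hM.2) (by
        intro u hu v hv hvM
        simp at hu hvM
        rw [h.symm]; exact hMQ v (hvM hv) u hu.1 hu.2)
    simp at hw
    exact ⟨w, hw.1, hw.2, hw'⟩
  obtain ⟨Y, hYS, hyY, hYQ, hYh⟩ := min_module h (· ≠ a) S X y hXS hX hQ hy
  obtain ⟨Z, hZS, hzZ, hZQ, hZh⟩ := min_module h (· ≠ a) S X z hXS hX hQ hz
  have nx : ∀ u ∈ S, x ≠ u := by rintro u hu rfl; exact hxS hu
  by_cases hzY : z ∈ Y
  · obtain ⟨w, hwS, hwY, hw⟩ := out' Y hYS ⟨y, hyY⟩ hYQ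
    have t1 := h.tri x y w (nx y hy) (nx w hwS) (by rintro rfl; exact hwY hyY)
    have t2 := h.tri x z w (nx z hz) (nx w hwS) (by rintro rfl; exact hwY hzY)
    have q1 := hYQ y hyY w hwS hwY
    have q2 := hYQ z hzY w hwS hwY
    have q3 := hYh w hwS hwY y hyY z hzY
    have s1 := h.symm w y
    have s2 := h.symm w z
    grind
  by_cases hyZ : y ∈ Z
  · obtain ⟨w, hwS, hwY, hw⟩ := out' Z hZS ⟨z, hzZ⟩ hZQ
    have t1 := h.tri x y w (nx y hy) (nx w hwS) (by rintro rfl; exact hwY hyZ)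
    have t2 := h.tri x z w (nx z hz) (nx w hwS) (by rintro rfl; exact hwY hzZ)
    have q1 := hZQ y hyZ w hwS hwY
    have q2 := hZQ z hzZ w hwS hwY
    have q3 := hZh w hwS hwY y hyZ z hzZ
    have s1 := h.symm w y
    have s2 := h.symm w z
    grind
  obtain ⟨w, hwY, hw⟩ := out Y hYS ⟨y, hyY⟩ hYQ
  obtain ⟨w', hwZ, hw'⟩ := out Z hZS ⟨z, hzZ⟩ hZQ
  have hwS := hYS.1 hwY
  have hwS' := hZS.1 hwZ
  have t1 := h.tri x z w (nx z hz) (nx w hwS) (by rintro rfl; exact hzY hwY)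
  have t2 := h.tri x y w' (nx y hy) (nx w' hwS') (by rintro rfl; exact hyZ hwZ)
  have q1 := hYQ w hwY z hz hzY
  have q2 := hZQ w' hwZ y hy hyZ
  have q3 := hYh z hz hzY y hyY w hwY
  have q4 := hZh y hy hyZ z hzZ w' hwZ
  have s1 := h.symm w z
  have s2 := h.symm w' y
  have s3 := h.symm y z
  grind

open Classical in
lemma three {c : V → V → α} (h : Gal c) {a b d : α} (hab : a ≠ b) (had : a ≠ d) (hbd : b ≠ d)
    (S : Finset V) : 2 ≤ S.card → 
    Cut c S (· ≠ a) ∨ Cut c S (· ≠ b) ∨ Cut c S (· ≠ d) := by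
  induction S using Finset.induction_on with
  | empty => simp
  | insert x S hx ih =>
    intro hcard
    rw [Finset.card_insert_of_notMem hx] at hcard
    by_cases h2 : 2 ≤ S.card
    · by_contra! hcon
      obtain ⟨h1, h2', h3⟩ := hcon
      rcases ih h2 with h' | h' | h'
      · exact three_aux h hab had hbd S x hx h' h1 h2' h3
      · exact three_aux h hab.symm hbd had S x hx h' h2' h1 h3
      · exact three_aux h had.symm hbd.symm hab S x hx h' h3 h1 h2'
    · have : S.card = 1 := by omega
      obtain ⟨y, rfl⟩ := Finset.card_eq_one.1 this
      have hxy : x ≠ y := by simpa using hx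
      have gen : ∀ e, c x y ≠ e → Cut c (insert x {y}) (· ≠ e) := by
        intro e he
        refine ⟨{x}, ?_, by simp, ?_⟩
        · refine Finset.ssubset_iff_subset_ne.2 ⟨by simp, ?_⟩
          intro hh
          have : y ∈ ({x} : Finset V) := by rw [hh]; simp
          simp at this; exact hxy this.symm
        · intro u hu v hv hvu
          simp at hu hv hvu
          subst hu
          rcases hv with rfl | rfl
          · exact absurd rfl hvu
          · exact he
      by_cases h1 : c x y = a
      · exact Or.inr (Or.inl (gen b (by rw [h1]; exact hab)))
      · exact Or.inl (gen a h1)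

open Classical in
/-- Gallai: some cut uses at most two colors. -/
lemma gallai {c : V → V → α} (h : Gal c) (n : ℕ) : ∀ S : Finset V, S.card = n → 2 ≤ S.card → 
    ∃ r b, Cut c S (fun e => e = r ∨ e = b) := by
  induction n using Nat.strong_induction_on with
  | _ n ih =>
  intro S hn h2
  by_cases hmod : ∃ M ⊂ S, 2 ≤ M.card ∧ ∀ z ∈ S, z ∉ M → ∀ x ∈ M, ∀ y ∈ M, c z x = c z y
  · obtain ⟨M, hMS, hM2, hMh⟩ := hmod
    obtain ⟨m, hm⟩ : M.Nonempty := Finset.card_pos.1 (by omega)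
    have hMc := Finset.card_lt_card hMS
    have hcard : (insert m (S \ M)).card = S.card - M.card + 1 := by
      rw [Finset.card_insert_of_notMem (by simp [hm]), Finset.card_sdiff_of_subset hMS.1]
    obtain ⟨r, b, X, hX, hXn, hXQ⟩ := ih (insert m (S \ M)).card (by omega) _ rfl (by omega)
    refine ⟨r, b, if m ∈ X then X ∪ M else X, ?_, ?_, ?_⟩
    · obtain ⟨v, hv, hvX⟩ := Finset.exists_of_ssubset hX
      have hsub : ∀ u ∈ X, u ∈ S := by
        intro u hu
        have := hX.1 hu
        simp at this
        rcases this with rfl | h'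
        · exact hMS.1 hm
        · exact h'.1
      split_ifs with hmX
      · refine (Finset.ssubset_iff_of_subset ?_).2 ⟨v, ?_, ?_⟩
        · intro u hu
          rcases Finset.mem_union.1 hu with h' | h'
          · exact hsub u h'
          · exact hMS.1 h'
        · grind
        · grind
      · refine (Finset.ssubset_iff_of_subset ?_).2 ⟨v, ?_, ?_⟩
        · exact hsub
        · have := hMS.1 hm
          grind
        · exact hvX
    · split_ifs
      · exact hXn.mono Finset.subset_union_left
      · exact hXn
    · have hs := h.symm
      split_ifs with hmX
      · intro x hx y hy hyX
        have hyM : y ∉ M := by grind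
        have hyX' : y ∉ X := by grind
        by_cases hxM : x ∈ M
        · have := hXQ m hmX y (by grind) hyX'
          have e := hMh y hy hyM x hxM m hm
          rw [hs x y, e, hs y m]; exact this
        · exact hXQ x (by grind) y (by grind) hyX'
      · intro x hx y hy hyX
        have hxM : x ∉ M := by
          intro hxM
          have := hX.1 hx
          grind
        by_cases hyM : y ∈ M
        · have := hXQ x hx m (by grind) hmX
          have hxS : x ∈ S := by
            have := hX.1 hx
            grind
          have e := hMh x hxS hxM y hyM m hm
          rw [e]; exact this
        · exact hXQ x hx y (by grind) hyX
  · have abs : ∀ e, Cut c S (· ≠ e) → ∀ u ∈ S, ∀ v ∈ S, u ≠ v → c u v ≠ e := by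
      rintro e ⟨X, hX, hXn, hXQ⟩ u hu v hv huv hc
      obtain ⟨M, hM, huM, hMQ, hMh⟩ := min_module h (· ≠ e) S X u hX hXn hXQ hu
      have hvM : v ∈ M := by
        by_contra hvM
        exact hMQ u huM v hv hvM hc
      refine hmod ⟨M, hM, ?_, hMh⟩
      exact Finset.one_lt_card.2 ⟨u, huM, v, hvM, huv⟩
    obtain ⟨u, hu, v, hv, huv⟩ := Finset.one_lt_card.1 h2
    have cutall : ∀ r b, (∀ x ∈ S, ∀ y ∈ S, x ≠ y → c x y = r ∨ c x y = b) → 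
        Cut c S (fun e => e = r ∨ e = b) := by
      intro r b hrb
      refine ⟨{u}, ?_, by simp, ?_⟩
      · refine (Finset.ssubset_iff_of_subset (by simpa using hu)).2 ⟨v, hv, by simpa using huv.symm⟩
      · intro x hx y hy hyx
        simp at hx hyx
        subst hx
        exact hrb _ hu y hy (Ne.symm hyx)
    by_cases hone : ∀ x ∈ S, ∀ y ∈ S, x ≠ y → c x y = c u v
    · exact ⟨c u v, c u v, cutall _ _ (fun x hx y hy hxy => Or.inl (hone x hx y hy hxy))⟩
    push Not at hone
    obtain ⟨x, hx, y, hy, hxy, hne⟩ := hone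
    refine ⟨c u v, c x y, cutall _ _ ?_⟩
    intro z hz w hw hzw
    by_contra! hcon
    rcases three h hne hcon.2.symm (hcon.1.symm) S h2 with h' | h' | h'
    · exact abs _ h' x hx y hy hxy rfl
    · exact abs _ h' u hu v hv huv rfl
    · exact abs _ h' z hz w hw hzw rfl

end GR

namespace GR

variable {V α : Type*}

/-- No monochromatic five-cycle. -/
def No5 (c : V → V → α) : Prop :=
  ∀ i x1 x2 x3 x4 x5, x1 ≠ x2 → x1 ≠ x3 → x1 ≠ x4 → x1 ≠ x5 → x2 ≠ x3 → x2 ≠ x4 → x2 ≠ x5 →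
    x3 ≠ x4 → x3 ≠ x5 → x4 ≠ x5 → 
    c x1 x2 = i → c x2 x3 = i → c x3 x4 = i → c x4 x5 = i → c x5 x1 = i → False

/-- No edge of color `i` inside `X`. -/
def Free (c : V → V → α) (X : Finset V) (i : α) : Prop :=
  ∀ x ∈ X, ∀ y ∈ X, x ≠ y → c x y ≠ i

/-- No path on four vertices of color `i` inside `X`. -/
def NoP4 (c : V → V → α) (X : Finset V) (i : α) : Prop :=
  ∀ x ∈ X, ∀ y ∈ X, ∀ z ∈ X, ∀ w ∈ X, x ≠ y → x ≠ z → x ≠ w → y ≠ z → y ≠ w → z ≠ w → 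
    c x y = i → c y z = i → c z w = i → False

/-- All edges between `X` and `Y` have color `i`. -/
def Full (c : V → V → α) (X Y : Finset V) (i : α) : Prop :=
  ∀ x ∈ X, ∀ y ∈ Y, c x y = i

lemma Full.symm {c : V → V → α} (h : Gal c) {X Y : Finset V} {i : α} (hf : Full c X Y i) :
    Full c Y X i := by
  intro y hy x hx
  rw [h.symm]; exact hf x hx y hy

lemma ex3 (A : Finset V) (x y : V) (h : 3 ≤ A.card) : ∃ z ∈ A, z ≠ x ∧ z ≠ y := by
  classical
  by_contra! hcon
  have : A ⊆ {x, y} := by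
    intro z hz
    by_cases hzx : z = x
    · simp [hzx]
    · simp [hcon z hz hzx]
  have h1 := Finset.card_le_card this
  have h2 := Finset.card_le_two (a := x) (b := y)
  omega

lemma ex2 (A : Finset V) (x : V) (h : 2 ≤ A.card) : ∃ z ∈ A, z ≠ x := by
  classical
  by_contra! hcon
  have : A ⊆ {x} := by
    intro z hz
    simp [hcon z hz]
  have h1 := Finset.card_le_card this
  simp at h1
  omega

/-- A complete bipartite `K_{3,2}` in color `i` forces the side of size three to be free. -/
lemma full_free {c : V → V → α} (h : Gal c) (h5 : No5 c) {A B : Finset V} {i : α}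
    (hd : Disjoint A B) (hf : Full c A B i) (hA : 3 ≤ A.card) (hB : 2 ≤ B.card) : Free c A i := by
  intro x hx y hy hxy hc
  obtain ⟨z, hz, hzx, hzy⟩ := ex3 A x y hA
  obtain ⟨b, hb, b', hb', hbb⟩ := Finset.one_lt_card.1 hB
  have nd : ∀ u ∈ A, ∀ v ∈ B, u ≠ v := fun u hu v hv => Finset.disjoint_left.1 hd |> fun g => by
    rintro rfl; exact g hu hv
  exact h5 i x y b z b' hxy (nd x hx b hb) hzx.symm (nd x hx b' hb') (nd y hy b hb) hzy.symm
    (nd y hy b' hb') (nd z hz b hb).symm hbb (nd z hz b' hb') hc (hf y hy b hb)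
    ((h.symm _ _).trans (hf z hz b hb)) (hf z hz b' hb') ((h.symm _ _).trans (hf x hx b' hb'))

/-- `K_{2,2}` contains a path on four vertices. -/
lemma full_noP4 {c : V → V → α} (h : Gal c) {S A B : Finset V} {i : α} (hAS : A ⊆ S) (hBS : B ⊆ S)
    (hd : Disjoint A B) (hf : Full c A B i) (hA : 2 ≤ A.card) (hB : 2 ≤ B.card)
    (hP : NoP4 c S i) : False := by
  obtain ⟨a, ha, a', ha', haa⟩ := Finset.one_lt_card.1 hA
  obtain ⟨b, hb, b', hb', hbb⟩ := Finset.one_lt_card.1 hB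
  have nd : ∀ u ∈ A, ∀ v ∈ B, u ≠ v := fun u hu v hv => Finset.disjoint_left.1 hd |> fun g => by
    rintro rfl; exact g hu hv
  exact hP a (hAS ha) b (hBS hb) a' (hAS ha') b' (hBS hb') (nd a ha b hb) haa (nd a ha b' hb')
    (nd a' ha' b hb).symm hbb (nd a' ha' b' hb') (hf a ha b hb) ((h.symm _ _).trans (hf a' ha' b hb))
    (hf a' ha' b' hb')

/-- The data of a homogeneous set `A` with its two neighbourhoods `R` and `B`. -/
structure Conf (c : V → V → α) (A R B : Finset V) (r b : α) : Prop where
  gal : Gal c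
  no5 : No5 c
  ne : r ≠ b
  dAR : Disjoint A R
  dAB : Disjoint A B
  dRB : Disjoint R B
  fR : Full c A R r
  fB : Full c A B b
  two : ∀ y ∈ R, ∀ x ∈ B, c y x = r ∨ c y x = b
  hA : 2 ≤ A.card

lemma Conf.swap {c : V → V → α} {A R B : Finset V} {r b : α} (h : Conf c A R B r b) :
    Conf c A B R b r where
  gal := h.gal
  no5 := h.no5
  ne := h.ne.symm
  dAR := h.dAB
  dAB := h.dAR
  dRB := h.dRB.symm
  fR := h.fB
  fB := h.fR
  two := by
    intro y hy x hx
    rw [h.gal.symm]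
    exact (h.two x hx y hy).symm
  hA := h.hA

lemma Conf.nAR {c : V → V → α} {A R B : Finset V} {r b : α} (h : Conf c A R B r b) :
    ∀ u ∈ A, ∀ v ∈ R, u ≠ v := by
  rintro u hu v hv rfl; exact Finset.disjoint_left.1 h.dAR hu hv
lemma Conf.nRB {c : V → V → α} {A R B : Finset V} {r b : α} (h : Conf c A R B r b) :
    ∀ u ∈ R, ∀ v ∈ B, u ≠ v := by
  rintro u hu v hv rfl; exact Finset.disjoint_left.1 h.dRB hu hv

/-- Two vertices joined by `r` in `B` have no distinct `r`-neighbours in `R`. -/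
lemma Conf.matching {c : V → V → α} {A R B : Finset V} {r b : α} (h : Conf c A R B r b)
    {x x' y y' : V} (hx : x ∈ B) (hx' : x' ∈ B) (hy : y ∈ R) (hy' : y' ∈ R) (hxx : x ≠ x')
    (hyy : y ≠ y') (hc : c x x' = r) (h1 : c x y = r) (h2 : c x' y' = r) : False := by
  obtain ⟨a, ha⟩ : A.Nonempty := Finset.card_pos.1 (by have := h.hA; omega)
  exact h.no5 r a y x x' y' (h.nAR a ha y hy) (h.swap.nAR a ha x hx) (h.swap.nAR a ha x' hx')
    (h.nAR a ha y' hy') (h.nRB y hy x hx) (h.nRB y hy x' hx') hyy hxx (h.nRB y' hy' x hx).symm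
    (h.nRB y' hy' x' hx').symm (h.fR a ha y hy) ((h.gal.symm _ _).trans h1) hc h2
    ((h.gal.symm _ _).trans (h.fR a ha y' hy'))

lemma Free.union {c : V → V → α} [DecidableEq V] (h : Gal c) {X Y : Finset V} {i : α}
    (hX : Free c X i) (hY : Free c Y i) (hXY : ∀ x ∈ X, ∀ y ∈ Y, c x y ≠ i) :
    Free c (X ∪ Y) i := by
  intro x hx y hy hxy
  rcases Finset.mem_union.1 hx with hx | hx <;> rcases Finset.mem_union.1 hy with hy | hy
  · exact hX x hx y hy hxy
  · exact hXY x hx y hy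
  · rw [h.symm]; exact hXY y hy x hx
  · exact hY x hx y hy hxy

lemma Free.mono {c : V → V → α} {X Y : Finset V} {i : α} (hX : Free c X i) (hYX : Y ⊆ X) :
    Free c Y i := fun x hx y hy => hX x (hYX hx) y (hYX hy)

lemma Free.single {c : V → V → α} {x : V} {i : α} : Free c {x} i := by
  intro u hu v hv huv
  simp at hu hv
  exact absurd (hu.trans hv.symm) huv

/-- `S` splits into two sets free of color `i`. -/
def Bip (c : V → V → α) [DecidableEq V] (S : Finset V) (i : α) : Prop :=
  ∃ X Y, X ∪ Y = S ∧ X ≠ S ∧ Y ≠ S ∧ Free c X i ∧ Free c Y i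

lemma bip_mk {c : V → V → α} [DecidableEq V] {S X Y : Finset V} {i : α} (hS : X ∪ Y = S)
    (hX : X.Nonempty) (hY : Y.Nonempty) (hd : Disjoint X Y) (h1 : Free c X i) (h2 : Free c Y i) :
    Bip c S i := by
  refine ⟨X, Y, hS, ?_, ?_, h1, h2⟩
  · rintro rfl
    obtain ⟨y, hy⟩ := hY
    exact Finset.disjoint_left.1 hd (hS ▸ Finset.mem_union_right _ hy) hy
  · rintro rfl
    obtain ⟨y, hy⟩ := hX
    exact Finset.disjoint_left.1 hd hy (hS ▸ Finset.mem_union_left _ hy)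

lemma Conf.alpha {c : V → V → α} [DecidableEq V] {A R B : Finset V} {r b : α}
    (h : Conf c A R B r b) (hAr : Free c A r) (hRr : Free c R r) (hBb : Free c B b)
    {x x' y y' : V} (hx : x ∈ B) (hx' : x' ∈ B) (hy : y ∈ R) (hy' : y' ∈ R) (hxx : x ≠ x')
    (hyy : y ≠ y') (hc : c x x' = r) (hcy : c y y' = b) (h1 : c x y = r) (h2 : c x y' = r)
    (h3 : c x' y = b) (h4 : c x' y' = b) : Bip c (A ∪ R ∪ B) r := by
  have hs := h.gal.symm
  have f1 : ∀ z ∈ R, c x' z = b := by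
    intro z hz
    rcases h.two z hz x' hx' with h' | h'
    · exfalso
      by_cases hzy : z = y
      · subst hzy
        have := h.ne; rw [hs] at h'; exact this (h'.symm.trans h3)
      · exact h.matching hx hx' hy hz hxx (Ne.symm hzy) hc h1 ((hs _ _).trans h')
    · rw [hs]; exact h'
  have f2 : ∀ u ∈ B, u ≠ x' → c u y = r ∧ c u y' = r := by
    intro u hu hux
    constructor
    · rcases h.two y hy u hu with h' | h'
      · rw [hs]; exact h'
      · exfalso
        exact h.swap.matching hy hy' hu hx' hyy hux hcy h' ((hs _ _).trans h4)
    · rcases h.two y' hy' u hu with h' | h'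
      · rw [hs]; exact h'
      · exfalso
        exact h.swap.matching hy hy' hx' hu hyy hux.symm hcy ((hs _ _).trans h3) h'
  obtain ⟨a, ha⟩ : A.Nonempty := Finset.card_pos.1 (by have := h.hA; omega)
  refine bip_mk (X := A ∪ B.erase x') (Y := R ∪ {x'}) ?_ ⟨a, by simp [ha]⟩ ⟨x', by simp⟩ ?_ ?_ ?_
  · ext z; simp only [Finset.mem_union, Finset.mem_erase, Finset.mem_singleton]; grind
  · rw [Finset.disjoint_left]
    have e1 := h.nAR
    have e2 := h.swap.nAR
    have e3 := h.nRB
    intro z hz hz'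
    simp only [Finset.mem_union, Finset.mem_erase, Finset.mem_singleton] at hz hz'
    grind
  · refine hAr.union h.gal ?_ ?_
    · intro u hu w hw huw hcu
      simp only [Finset.mem_erase] at hu hw
      exact h.matching hu.2 hw.2 hy hy' huw hyy hcu (f2 u hu.2 hu.1).1 (f2 w hw.2 hw.1).2
    · intro u hu w hw
      rw [h.fB u hu w (Finset.mem_of_mem_erase hw)]; exact h.ne.symm
  · refine hRr.union h.gal Free.single ?_
    intro u hu w hw
    simp only [Finset.mem_singleton] at hw
    subst hw
    rw [hs, f1 u hu]; exact h.ne.symm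

set_option maxHeartbeats 2000000 in
/-- Both neighbourhoods large, `A` free of color `b`. -/
lemma Conf.large' {c : V → V → α} [DecidableEq V] {A R B : Finset V} {r b : α}
    (h : Conf c A R B r b) (hR : 3 ≤ R.card) (hB : 3 ≤ B.card) (hAb : Free c A b) :
    Bip c (A ∪ R ∪ B) r ∨ Bip c (A ∪ R ∪ B) b := by
  have hs := h.gal.symm
  have hRr : Free c R r := full_free h.gal h.no5 h.dAR.symm (h.fR.symm h.gal) hR h.hA
  have hBb : Free c B b := full_free h.gal h.no5 h.dAB.symm (h.fB.symm h.gal) hB h.hA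
  obtain ⟨a, ha⟩ : A.Nonempty := Finset.card_pos.1 (by have := h.hA; omega)
  obtain ⟨x0, hx0⟩ : B.Nonempty := Finset.card_pos.1 (by omega)
  obtain ⟨y0, hy0⟩ : R.Nonempty := Finset.card_pos.1 (by omega)
  have ne := h.ne
  have e1 := h.nAR
  have e2 := h.swap.nAR
  have e3 := h.nRB
  by_cases hRb : Free c R b
  · right
    refine bip_mk (X := A ∪ R) (Y := B) rfl ⟨a, by simp [ha]⟩ ⟨x0, hx0⟩ ?_ ?_ hBb
    · rw [Finset.disjoint_union_left]; exact ⟨h.dAB, h.dRB⟩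
    · refine hAb.union h.gal hRb ?_
      intro u hu w hw
      rw [h.fR u hu w hw]; exact h.ne
  unfold Free at hRb
  push Not at hRb
  obtain ⟨y, hy, y', hy', hyy, hcy⟩ := hRb
  have mb := fun {x x' : V} (hx : x ∈ B) (hx' : x' ∈ B) (hxx : x ≠ x') =>
    h.swap.matching (x := y) (x' := y') (y := x) (y' := x') hy hy' hx hx' hyy hxx hcy
  by_cases hAr : Free c A r
  · by_cases hBr : Free c B r
    · left
      refine bip_mk (X := A ∪ B) (Y := R) ?_ ⟨a, by simp [ha]⟩ ⟨y0, hy0⟩ ?_ ?_ hRr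
      · ext z; simp only [Finset.mem_union]; tauto
      · rw [Finset.disjoint_union_left]; exact ⟨h.dAR, h.dRB.symm⟩
      · refine hAr.union h.gal hBr ?_
        intro u hu w hw
        rw [h.fB u hu w hw]; exact h.ne.symm
    unfold Free at hBr
    push Not at hBr
    obtain ⟨x, hx, x', hx', hxx, hcx⟩ := hBr
    have mr := fun {z z' : V} (hz : z ∈ R) (hz' : z' ∈ R) (hzz : z ≠ z') =>
      h.matching (x := x) (x' := x') (y := z) (y' := z') hx hx' hz hz' hxx hzz hcx
    have m1 := mr hy hy' hyy
    have m2 := mr hy' hy hyy.symm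
    have m3 := mb hx hx' hxx
    have m4 := mb hx' hx hxx.symm
    have t1 := h.two y hy x hx
    have t2 := h.two y hy x' hx'
    have t3 := h.two y' hy' x hx
    have t4 := h.two y' hy' x' hx'
    have hsw : A ∪ B ∪ R = A ∪ R ∪ B := by ext z; simp only [Finset.mem_union]; tauto
    rw [hs y x] at t1 m3
    rw [hs y x'] at t2 m4
    rw [hs y' x] at t3 m4
    rw [hs y' x'] at t4 m3
    rcases t1 with t1 | t1 <;> rcases t2 with t2 | t2 <;> rcases t3 with t3 | t3 <;>
      rcases t4 with t4 | t4 <;> first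
        | exact (m1 t1 t4).elim
        | exact (m2 t3 t2).elim
        | exact (m3 t1 t4).elim
        | exact (m4 t2 t3).elim
        | exact Or.inl (h.alpha hAr hRr hBb hx hx' hy hy' hxx hyy hcx hcy t1 t3 t2 t4)
        | exact Or.inl (h.alpha hAr hRr hBb hx' hx hy hy' hxx.symm hyy
            ((hs _ _).trans hcx) hcy t2 t4 t1 t3)
        | exact Or.inr (hsw ▸ h.swap.alpha hAb hBb hRr hy hy' hx hx' hyy hxx hcy hcx
            ((hs _ _).trans t1) ((hs _ _).trans t2) ((hs _ _).trans t3) ((hs _ _).trans t4))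
        | exact Or.inr (hsw ▸ h.swap.alpha hAb hBb hRr hy' hy hx hx' hyy.symm hxx
            ((hs _ _).trans hcy) hcx
            ((hs _ _).trans t3) ((hs _ _).trans t4) ((hs _ _).trans t1) ((hs _ _).trans t2))
  · right
    unfold Free at hAr
    push Not at hAr
    obtain ⟨p, hp, p', hp', hpp, hcp⟩ := hAr
    -- each vertex of B has at most one r-neighbour in R
    have one : ∀ x ∈ B, ∀ z ∈ R, ∀ z' ∈ R, z ≠ z' → c z x = r → c z' x = r → False := by
      intro x hx z hz z' hz' hzz h1 h2
      exact h.no5 r p p' z x z' hpp (e1 p hp z hz) (e2 p hp x hx) (e1 p hp z' hz')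
        (e1 p' hp' z hz) (e2 p' hp' x hx) (e1 p' hp' z' hz') (e3 z hz x hx) hzz
        (e3 z' hz' x hx).symm hcp (h.fR p' hp' z hz) h1 ((hs _ _).trans h2)
        ((hs _ _).trans (h.fR p hp z' hz'))
    have fin : ∀ w ∈ R, ∀ w' ∈ R, w ≠ w' → (∀ x ∈ B, c w' x = r) → 
        Bip c (A ∪ R ∪ B) b := by
      intro w hw w' hw' hww hall
      have hb : ∀ z ∈ R, z ≠ w' → ∀ x ∈ B, c z x = b := by
        intro z hz hzw x hx
        rcases h.two z hz x hx with h' | h'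
        · exact (one x hx z hz w' hw' hzw h' (hall x hx)).elim
        · exact h'
      refine bip_mk (X := A ∪ R.erase w') (Y := B ∪ {w'}) ?_ ⟨a, by simp [ha]⟩ ⟨w', by simp⟩
        ?_ ?_ ?_
      · ext z; simp only [Finset.mem_union, Finset.mem_erase, Finset.mem_singleton]; grind
      · rw [Finset.disjoint_left]
        intro z hz hz'
        simp only [Finset.mem_union, Finset.mem_erase, Finset.mem_singleton] at hz hz'
        grind
      · refine hAb.union h.gal ?_ ?_
        · intro u hu v hv huv hcu
          simp only [Finset.mem_erase] at hu hv
          obtain ⟨x, hx, x', hx', hxx⟩ := Finset.one_lt_card.1 (show 1 < B.card by omega)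
          exact h.swap.matching hu.2 hv.2 hx hx' huv hxx hcu (hb u hu.2 hu.1 x hx)
            (hb v hv.2 hv.1 x' hx')
        · intro u hu v hv
          rw [h.fR u hu v (Finset.mem_of_mem_erase hv)]; exact ne
      · refine hBb.union h.gal Free.single ?_
        intro u hu v hv
        simp only [Finset.mem_singleton] at hv
        subst hv
        rw [hs, hall u hu]; exact ne
    -- key claim
    have key : ∀ w ∈ R, ∀ w' ∈ R, w ≠ w' → c w w' = b → (∃ x ∈ B, c w x = b) → 
        ∀ x ∈ B, c w' x = r := by
      rintro w hw w' hw' hww hcw ⟨x1, hx1, hb1⟩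
      have g1 : ∀ x ∈ B, x ≠ x1 → c w' x = r ∧ c w x = b := by
        intro x hx hxx
        have q1 : c w' x = r := by
          rcases h.two w' hw' x hx with h' | h'
          · exact h'
          · exact (h.swap.matching hw hw' hx1 hx hww hxx.symm hcw hb1 h').elim
        refine ⟨q1, ?_⟩
        rcases h.two w hw x hx with h' | h'
        · exact (one x hx w hw w' hw' hww h' q1).elim
        · exact h'
      intro x hx
      by_cases hxx : x = x1
      · subst hxx
        obtain ⟨x2, hx2, hne⟩ := ex2 B x (by omega)
        rcases h.two w' hw' x hx with h' | h'
        · exact h'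
        · exact (h.swap.matching hw hw' hx2 hx hww hne hcw (g1 x2 hx2 hne).2 h').elim
      · exact (g1 x hx hxx).1
    by_cases hyb : ∃ x ∈ B, c y x = b
    · exact fin y hy y' hy' hyy (key y hy y' hy' hyy hcy hyb)
    · refine fin y' hy' y hy hyy.symm ?_
      intro x hx
      rcases h.two y hy x hx with h' | h'
      · exact h'
      · exact (hyb ⟨x, hx, h'⟩).elim

lemma Conf.large {c : V → V → α} [DecidableEq V] {A R B : Finset V} {r b : α}
    (h : Conf c A R B r b) (hR : 3 ≤ R.card) (hB : 3 ≤ B.card) :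
    Bip c (A ∪ R ∪ B) r ∨ Bip c (A ∪ R ∪ B) b := by
  by_cases hAb : Free c A b
  · exact h.large' hR hB hAb
  · have hsw : A ∪ B ∪ R = A ∪ R ∪ B := by ext z; simp only [Finset.mem_union]; tauto
    have hAr : Free c A r := by
      by_cases h3 : 3 ≤ A.card
      · exact full_free h.gal h.no5 h.dAR h.fR h3 (by omega)
      · unfold Free at hAb
        push Not at hAb
        obtain ⟨x, hx, y, hy, hxy, hcy⟩ := hAb
        have h2 := h.hA
        have hAe : {x, y} = A := Finset.eq_of_subset_of_card_le (by
          intro z hz; simp at hz; rcases hz with rfl | rfl <;> assumption) (by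
          rw [Finset.card_pair hxy]; omega)
        have ne := h.ne
        have hs := h.gal.symm y x
        intro u hu v hv huv
        rw [← hAe] at hu hv
        simp at hu hv
        rcases hu with rfl | rfl <;> rcases hv with rfl | rfl <;> grind
    have := h.swap.large' hB hR hAr
    rw [hsw] at this
    exact this.symm

end GR

namespace GR

variable {V α : Type*}

lemma ex4 (A : Finset V) (x y w : V) (h : 4 ≤ A.card) : ∃ z ∈ A, z ≠ x ∧ z ≠ y ∧ z ≠ w := by
  classical
  by_contra! hcon
  have : A ⊆ {x, y, w} := by
    intro z hz
    by_cases hzx : z = x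
    · simp [hzx]
    · by_cases hzy : z = y
      · simp [hzy]
      · simp [hcon z hz hzx hzy]
  have h1 := Finset.card_le_card this
  have h2 := Finset.card_le_three (a := x) (b := y) (c := w)
  omega

lemma card5 {T : Finset V} [DecidableEq V] (h : T.card = 5) : ∃ x1 x2 x3 x4 x5, x1 ≠ x2 ∧ x1 ≠ x3 ∧
    x1 ≠ x4 ∧ x1 ≠ x5 ∧ x2 ≠ x3 ∧ x2 ≠ x4 ∧ x2 ≠ x5 ∧ x3 ≠ x4 ∧ x3 ≠ x5 ∧ x4 ≠ x5 ∧ 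
      T = {x1, x2, x3, x4, x5} := by
  obtain ⟨a, t, hat, rfl, ht⟩ := Finset.card_eq_succ.1 h
  obtain ⟨x, y, z, w, h1, h2, h3, h4, h5, h6, rfl⟩ := Finset.card_eq_four.1 ht
  simp at hat
  exact ⟨a, x, y, z, w, hat.1, hat.2.1, hat.2.2.1, hat.2.2.2, h1, h2, h3, h4, h5, h6, rfl⟩

lemma noK4 {c : V → V → α} (h : Gal c) (h5 : No5 c) {r b : α} (S M : Finset V)
    (hS : 9 ≤ S.card) (hc : ∀ x ∈ S, ∀ y ∈ S, x ≠ y → c x y = r ∨ c x y = b)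
    (hMS : M ⊆ S) (hM : M.card = 4) (hMb : ∀ x ∈ M, ∀ y ∈ M, x ≠ y → c x y = b) : False := by
  classical
  have hs := h.symm
  have hO : 5 ≤ (S \ M).card := by rw [Finset.card_sdiff_of_subset hMS]; omega
  have nd : ∀ z ∈ S \ M, ∀ m ∈ M, z ≠ m := by
    rintro z hz m hm rfl; simp at hz; exact hz.2 hm
  have exc : ∀ z ∈ S \ M, ∃ m0, ∀ m ∈ M, m ≠ m0 → c z m = r := by
    intro z hz
    by_contra! hcon
    obtain ⟨m1, hm1, -, h1⟩ := hcon z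
    obtain ⟨m2, hm2, h12, h2⟩ := hcon m1
    have hzS : z ∈ S := (Finset.mem_sdiff.1 hz).1
    have b1 := (hc z hzS m1 (hMS hm1) (nd z hz m1 hm1)).resolve_left h1
    have b2 := (hc z hzS m2 (hMS hm2) (nd z hz m2 hm2)).resolve_left h2
    obtain ⟨m3, hm3, h31, h32⟩ := ex3 M m1 m2 (by omega)
    obtain ⟨m4, hm4, h41, h42, h43⟩ := ex4 M m1 m2 m3 (by omega)
    exact h5 b z m1 m3 m4 m2 (nd z hz m1 hm1) (nd z hz m3 hm3) (nd z hz m4 hm4) (nd z hz m2 hm2)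
      h31.symm h41.symm h12.symm h43.symm h32 h42 b1 (hMb _ hm1 _ hm3 h31.symm)
      (hMb _ hm3 _ hm4 h43.symm) (hMb _ hm4 _ hm2 h42) ((hs _ _).trans b2)
  have allb : ∀ x ∈ S \ M, ∀ y ∈ S \ M, x ≠ y → c x y = b := by
    intro x hx y hy hxy
    refine (hc x (Finset.mem_sdiff.1 hx).1 y (Finset.mem_sdiff.1 hy).1 hxy).resolve_left ?_
    intro hr
    obtain ⟨w, hw, hwx, hwy⟩ := ex3 (S \ M) x y (by omega)
    obtain ⟨a, ha⟩ := exc x hx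
    obtain ⟨d, hd⟩ := exc y hy
    obtain ⟨e, he⟩ := exc w hw
    obtain ⟨m1, hm1, h1a, h1e⟩ := ex3 M a e (by omega)
    obtain ⟨m2, hm2, h2d, h2e, h21⟩ := ex4 M d e m1 (by omega)
    exact h5 r x m1 w m2 y (nd x hx m1 hm1) hwx.symm (nd x hx m2 hm2) hxy (nd w hw m1 hm1).symm
      h21.symm (nd y hy m1 hm1).symm (nd w hw m2 hm2) hwy (nd y hy m2 hm2).symm
      (ha m1 hm1 h1a) ((hs _ _).trans (he m1 hm1 h1e)) (he m2 hm2 h2e)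
      ((hs _ _).trans (hd m2 hm2 h2d)) ((hs _ _).trans hr)
  obtain ⟨T, hT, hT5⟩ := Finset.exists_subset_card_eq hO
  obtain ⟨x1, x2, x3, x4, x5, n⟩ : ∃ x1 x2 x3 x4 x5, x1 ≠ x2 ∧ x1 ≠ x3 ∧ x1 ≠ x4 ∧ x1 ≠ x5 ∧ 
      x2 ≠ x3 ∧ x2 ≠ x4 ∧ x2 ≠ x5 ∧ x3 ≠ x4 ∧ x3 ≠ x5 ∧ x4 ≠ x5 ∧ 
      T = {x1, x2, x3, x4, x5} := card5 hT5
  obtain ⟨n12, n13, n14, n15, n23, n24, n25, n34, n35, n45, rfl⟩ := n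
  have q1 : x1 ∈ S \ M := hT (by simp)
  have q2 : x2 ∈ S \ M := hT (by simp)
  have q3 : x3 ∈ S \ M := hT (by simp)
  have q4 : x4 ∈ S \ M := hT (by simp)
  have q5 : x5 ∈ S \ M := hT (by simp)
  exact h5 b x1 x2 x3 x4 x5 n12 n13 n14 n15 n23 n24 n25 n34 n35 n45 (allb _ q1 _ q2 n12)
    (allb _ q2 _ q3 n23) (allb _ q3 _ q4 n34) (allb _ q4 _ q5 n45) (allb _ q5 _ q1 n15.symm)

/-- Explicit version of `noK4`. -/
lemma noK4' {c : V → V → α} (h : Gal c) (h5 : No5 c) {r b : α} (S : Finset V)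
    (hS : 9 ≤ S.card) (hc : ∀ x ∈ S, ∀ y ∈ S, x ≠ y → c x y = r ∨ c x y = b)
    {x y z w : V} (hx : x ∈ S) (hy : y ∈ S) (hz : z ∈ S) (hw : w ∈ S) (xy : x ≠ y) (xz : x ≠ z)
    (xw : x ≠ w) (yz : y ≠ z) (yw : y ≠ w) (zw : z ≠ w)
    (h1 : c x y = b) (h2 : c x z = b) (h3 : c x w = b) (h4 : c y z = b) (h5' : c y w = b)
    (h6 : c z w = b) : False := by
  classical
  have hs := h.symm
  refine noK4 h h5 S {x, y, z, w} hS hc ?_ ?_ ?_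
  · intro u hu
    simp at hu
    rcases hu with rfl | rfl | rfl | rfl <;> assumption
  · rw [Finset.card_eq_four]; exact ⟨x, y, z, w, xy, xz, xw, yz, yw, zw, rfl⟩
  · intro u hu v hv huv
    simp at hu hv
    rcases hu with rfl | rfl | rfl | rfl <;> rcases hv with rfl | rfl | rfl | rfl <;>
      first | exact absurd rfl huv | assumption | (rw [hs]; assumption)

/-- No vertex has five neighbours in one color. -/
lemma deg5 {c : V → V → α} (h : Gal c) (h5 : No5 c) {r b : α} (S : Finset V)
    (hS : 9 ≤ S.card) (hc : ∀ x ∈ S, ∀ y ∈ S, x ≠ y → c x y = r ∨ c x y = b)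
    (v : V) (hv : v ∈ S) (N : Finset V) (hN : N ⊆ S) (hvN : v ∉ N) (hr : ∀ x ∈ N, c v x = r)
    (hN5 : 5 ≤ N.card) : False := by
  classical
  have hs := h.symm
  have nv : ∀ x ∈ N, v ≠ x := by rintro x hx rfl; exact hvN hx
  have hcN : ∀ x ∈ N, ∀ y ∈ N, x ≠ y → c x y ≠ r → c x y = b := fun x hx y hy hxy hn =>
    (hc x (hN hx) y (hN hy) hxy).resolve_left hn
  have p4 : ∀ x ∈ N, ∀ y ∈ N, ∀ z ∈ N, ∀ w ∈ N, x ≠ y → x ≠ z → x ≠ w → y ≠ z → y ≠ w → z ≠ w → 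
      c x y = r → c y z = r → c z w = r → False := by
    intro x hx y hy z hz w hw xy xz xw yz yw zw h1 h2 h3
    exact h5 r v x y z w (nv x hx) (nv y hy) (nv z hz) (nv w hw) xy xz xw yz yw zw (hr x hx) h1 h2
      h3 ((hs _ _).trans (hr w hw))
  have tri : ∀ x ∈ N, ∀ y ∈ N, ∀ z ∈ N, x ≠ y → x ≠ z → y ≠ z → 
      c x y = r → c y z = r → c x z = r → False := by
    intro x hx y hy z hz xy xz yz h1 h2 h3
    exact noK4' h h5 (r := b) (b := r) S hS (fun x hx y hy hxy => (hc x hx y hy hxy).symm) hv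
      (hN hx) (hN hy) (hN hz) (nv x hx) (nv y hy) (nv z hz) xy xz yz (hr x hx) (hr y hy) (hr z hz)
      h1 h3 h2
  by_cases hadj : ∃ u ∈ N, ∃ l1 ∈ N, ∃ l2 ∈ N, u ≠ l1 ∧ u ≠ l2 ∧ l1 ≠ l2 ∧ c u l1 = r ∧ c u l2 = r
  · obtain ⟨u, hu, l1, hl1, l2, hl2, n1, n2, n12, r1, r2⟩ := hadj
    obtain ⟨w1, hw1, w1u, w1l, w1l'⟩ := ex4 N u l1 l2 (by omega)
    obtain ⟨w2, hw2, w2u, w2l, w2l', w21⟩ : ∃ z ∈ N, z ≠ u ∧ z ≠ l1 ∧ z ≠ l2 ∧ z ≠ w1 := by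
      obtain ⟨z, hz, h1, h2, h3⟩ := ex4 (N.erase w1) u l1 l2 (by
        rw [Finset.card_erase_of_mem hw1]; omega)
      exact ⟨z, Finset.mem_of_mem_erase hz, h1, h2, h3, Finset.ne_of_mem_erase hz⟩
    -- blue edges
    have b12 : c l1 l2 = b := hcN _ hl1 _ hl2 n12 fun hh =>
      tri u hu l1 hl1 l2 hl2 n1 n2 n12 r1 hh r2
    have lw1 : ∀ w ∈ N, w ≠ u → w ≠ l1 → w ≠ l2 → c l1 w = b := by
      intro w hw wu wl wl'
      refine hcN _ hl1 _ hw wl.symm fun hh => ?_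
      exact p4 w hw l1 hl1 u hu l2 hl2 wl wu wl' n1.symm n12 n2 ((hs _ _).trans hh)
        ((hs _ _).trans r1) r2
    have lw2 : ∀ w ∈ N, w ≠ u → w ≠ l1 → w ≠ l2 → c l2 w = b := by
      intro w hw wu wl wl'
      refine hcN _ hl2 _ hw wl'.symm fun hh => ?_
      exact p4 w hw l2 hl2 u hu l1 hl1 wl' wu wl n2.symm n12.symm n1 ((hs _ _).trans hh)
        ((hs _ _).trans r2) r1
    have uw : ∀ w ∈ N, ∀ w' ∈ N, w ≠ u → w ≠ l1 → w ≠ l2 → w' ≠ u → w' ≠ l1 → w' ≠ l2 → 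
        w ≠ w' → c u w = b := by
      intro w hw w' hw' wu wl wl' wu' wl1 wl2 ww
      refine hcN _ hu _ hw wu.symm fun hh => ?_
      have bw : c w w' = b := by
        refine hcN _ hw _ hw' ww fun hh' => ?_
        exact p4 w' hw' w hw u hu l1 hl1 ww.symm wu' wl1 wu wl n1 ((hs _ _).trans hh')
          ((hs _ _).trans hh) r1
      exact noK4' h h5 (r := r) (b := b) S hS hc (hN hl1) (hN hl2) (hN hw) (hN hw') n12 wl.symm
        wl1.symm wl'.symm wl2.symm ww b12 (lw1 w hw wu wl wl') (lw1 w' hw' wu' wl1 wl2)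
        (lw2 w hw wu wl wl') (lw2 w' hw' wu' wl1 wl2) bw
    exact h5 b u w1 l1 l2 w2 w1u.symm n1 n2 w2u.symm w1l w1l' w21.symm n12 w2l.symm w2l'.symm
      (uw w1 hw1 w2 hw2 w1u w1l w1l' w2u w2l w2l' w21.symm)
      ((hs _ _).trans (lw1 w1 hw1 w1u w1l w1l')) b12 (lw2 w2 hw2 w2u w2l w2l')
      ((hs _ _).trans (uw w2 hw2 w1 hw1 w2u w2l w2l' w1u w1l w1l' w21))
  · push Not at hadj
    have cyc : ∀ x1 ∈ N, ∀ x2 ∈ N, ∀ x3 ∈ N, ∀ x4 ∈ N, ∀ x5 ∈ N, 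
        x1 ≠ x2 → x1 ≠ x3 → x1 ≠ x4 → x1 ≠ x5 → x2 ≠ x3 → x2 ≠ x4 → x2 ≠ x5 →
        x3 ≠ x4 → x3 ≠ x5 → x4 ≠ x5 → c x1 x2 = r → c x4 x5 ≠ r → False := by
      intro x1 q1 x2 q2 x3 q3 x4 q4 x5 q5 n12 n13 n14 n15 n23 n24 n25 n34 n35 n45 hr1 hn
      have b1 : ∀ x ∈ N, x1 ≠ x → x2 ≠ x → c x1 x = b := fun x hx h1 h2 =>
        hcN _ q1 _ hx h1 (hadj x1 q1 x2 q2 x hx n12 h1 h2 hr1)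
      have b2 : ∀ x ∈ N, x1 ≠ x → x2 ≠ x → c x2 x = b := fun x hx h1 h2 =>
        hcN _ q2 _ hx h2 (hadj x2 q2 x1 q1 x hx n12.symm h2 h1 ((hs _ _).trans hr1))
      exact h5 b x1 x3 x2 x4 x5 n13 n12 n14 n15 n23.symm n34 n35 n24 n25 n45 (b1 x3 q3 n13 n23)
        ((hs _ _).trans (b2 x3 q3 n13 n23)) (b2 x4 q4 n14 n24) (hcN _ q4 _ q5 n45 hn)
        ((hs _ _).trans (b1 x5 q5 n15 n25))
    obtain ⟨T, hT, hT5⟩ := Finset.exists_subset_card_eq hN5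
    by_cases hred : ∃ x ∈ T, ∃ y ∈ T, x ≠ y ∧ c x y = r
    · obtain ⟨x, hx, y, hy, hxy, hr1⟩ := hred
      have h3 : ((T.erase x).erase y).card = 3 := by
        rw [Finset.card_erase_of_mem (by simp [hy, hxy.symm]), Finset.card_erase_of_mem hx]
        omega
      obtain ⟨z1, z2, z3, m12, m13, m23, hz⟩ := Finset.card_eq_three.1 h3
      have k1 : z1 ∈ (T.erase x).erase y := by rw [hz]; simp
      have k2 : z2 ∈ (T.erase x).erase y := by rw [hz]; simp
      have k3 : z3 ∈ (T.erase x).erase y := by rw [hz]; simp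
      simp only [Finset.mem_erase] at k1 k2 k3
      have a1 := hT k1.2.2
      have a2 := hT k2.2.2
      have a3 := hT k3.2.2
      by_cases hh : c z1 z2 = r
      · exact cyc x (hT hx) y (hT hy) z2 a2 z1 a1 z3 a3 hxy k2.2.1.symm k1.2.1.symm k3.2.1.symm
          k2.1.symm k1.1.symm k3.1.symm m12.symm m23 m13 hr1 (hadj z1 a1 z2 a2 z3 a3 m12 m13 m23 hh)
      · exact cyc x (hT hx) y (hT hy) z3 a3 z1 a1 z2 a2 hxy k3.2.1.symm k1.2.1.symm k2.2.1.symm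
          k3.1.symm k1.1.symm k2.1.symm m13.symm m23.symm m12 hr1 hh
    · push Not at hred
      obtain ⟨x1, x2, x3, x4, x5, n12, n13, n14, n15, n23, n24, n25, n34, n35, n45, rfl⟩ := 
        card5 hT5
      have allb : ∀ x ∈ ({x1, x2, x3, x4, x5} : Finset V), ∀ y ∈ ({x1, x2, x3, x4, x5} : Finset V), 
          x ≠ y → c x y = b := fun x hx y hy hxy => 
        hcN x (hT hx) y (hT hy) hxy (hred x hx y hy hxy)
      exact h5 b x1 x2 x3 x4 x5 n12 n13 n14 n15 n23 n24 n25 n34 n35 n45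
        (allb _ (by simp) _ (by simp) n12)
        (allb _ (by simp) _ (by simp) n23) (allb _ (by simp) _ (by simp) n34)
        (allb _ (by simp) _ (by simp) n45) (allb _ (by simp) _ (by simp) n15.symm)

/-- `R(C₅, C₅) ≤ 9`. -/
lemma r55 {c : V → V → α} (h : Gal c) (h5 : No5 c) {r b : α} (hrb : r ≠ b) (S : Finset V)
    (hS : S.card = 9) (hc : ∀ x ∈ S, ∀ y ∈ S, x ≠ y → c x y = r ∨ c x y = b) : False := by
  classical
  have hs := h.symm
  let N := fun (i : α) (v : V) => S.filter fun x => v ≠ x ∧ c v x = i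
  have memN : ∀ i v x, x ∈ N i v ↔ x ∈ S ∧ v ≠ x ∧ c v x = i := by
    intro i v x; simp [N]
  have hc' : ∀ x ∈ S, ∀ y ∈ S, x ≠ y → c x y = b ∨ c x y = r := fun x hx y hy hxy =>
    (hc x hx y hy hxy).symm
  have hsum : ∀ v ∈ S, (N r v).card + (N b v).card = 8 := by
    intro v hv
    rw [← Finset.card_union_of_disjoint]
    · have : N r v ∪ N b v = S.erase v := by
        ext x
        simp only [Finset.mem_union, memN, Finset.mem_erase]
        have := hc v hv x
        grind
      rw [this, Finset.card_erase_of_mem hv, hS]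
    · rw [Finset.disjoint_left]
      intro x h1 h2
      rw [memN] at h1 h2
      exact hrb (h1.2.2.symm.trans h2.2.2)
  have hNr : ∀ v ∈ S, (N r v).card = 4 ∧ (N b v).card = 4 := by
    intro v hv
    have d1 : ¬ 5 ≤ (N r v).card := fun hh => deg5 h h5 S hS.ge hc v hv (N r v)
      (Finset.filter_subset _ _) (by simp [N]) (fun x hx => ((memN _ _ _).1 hx).2.2) hh
    have d2 : ¬ 5 ≤ (N b v).card := fun hh => deg5 h h5 S hS.ge hc' v hv (N b v)
      (Finset.filter_subset _ _) (by simp [N]) (fun x hx => ((memN _ _ _).1 hx).2.2) hh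
    have := hsum v hv
    omega
  obtain ⟨v, hv⟩ : S.Nonempty := Finset.card_pos.1 (by omega)
  have memR := memN r v
  have memB := memN b v
  have split : ∀ x ∈ S, v ≠ x → x ∈ N r v ∨ x ∈ N b v := by
    intro x hx hvx
    rcases hc v hv x hx hvx with h' | h'
    · exact Or.inl ((memR x).2 ⟨hx, hvx, h'⟩)
    · exact Or.inr ((memB x).2 ⟨hx, hvx, h'⟩)
  have nRB : ∀ x ∈ N r v, ∀ y ∈ N b v, x ≠ y := by
    rintro x hx y hy rfl
    rw [memR] at hx; rw [memB] at hy
    exact hrb (hx.2.2.symm.trans hy.2.2)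
  by_cases hadj : ∃ u ∈ N r v, ∃ l1 ∈ N r v, ∃ l2 ∈ N r v,
      u ≠ l1 ∧ u ≠ l2 ∧ l1 ≠ l2 ∧ c u l1 = r ∧ c u l2 = r
  · obtain ⟨u, hu', l1, hl1', l2, hl2', n1, n2, n12, r1, r2⟩ := hadj
    have hu := (memR u).1 hu'
    have hl1 := (memR l1).1 hl1'
    have hl2 := (memR l2).1 hl2'
    have sub : ∀ l ∈ N r v, ∀ l' ∈ N r v, u ≠ l → u ≠ l' → l ≠ l' → c u l = r → c u l' = r → 
        ∀ x ∈ S, x ≠ v → x ≠ u → l ≠ x → c l x = r → x ∈ N b v := by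
      intro l hl l' hl' m1 m2 m12 q1 q2 x hx xv xu lx hlx
      rcases split x hx xv.symm with hxR | hxB
      · exfalso
        have hxR' := (memR x).1 hxR
        rw [memR] at hl hl'
        by_cases hxl : x = l'
        · subst hxl
          exact noK4' h h5 (r := b) (b := r) S hS.ge hc' hv hu.1 hl.1 hl'.1 hu.2.1 hl.2.1 hl'.2.1
            m1 m2 m12 hu.2.2 hl.2.2 hl'.2.2 q1 q2 hlx
        · exact h5 r v x l u l' xv.symm hl.2.1 hu.2.1 hl'.2.1 lx.symm xu hxl m1.symm m12 m2
            hxR'.2.2 ((hs _ _).trans hlx) ((hs _ _).trans q1) q2 ((hs _ _).trans hl'.2.2)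
      · exact hxB
    let D := fun l => ((N r l).erase v).erase u
    have hD : ∀ l ∈ N r v, ∀ l' ∈ N r v, u ≠ l → u ≠ l' → l ≠ l' → c u l = r → c u l' = r → 
        D l ⊆ N b v ∧ (D l).card = 2 := by
      intro l hl l' hl' m1 m2 m12 q1 q2
      have hl3 := (memR l).1 hl
      constructor
      · intro x hx
        simp only [D, Finset.mem_erase, memN] at hx
        exact sub l hl l' hl' m1 m2 m12 q1 q2 x hx.2.2.1 hx.2.1 hx.1 hx.2.2.2.1 hx.2.2.2.2
      · have := (hNr l hl3.1).1
        rw [Finset.card_erase_of_mem, Finset.card_erase_of_mem, this]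
        · rw [memN]; exact ⟨hv, hl3.2.1.symm, (hs _ _).trans hl3.2.2⟩
        · simp only [Finset.mem_erase, memN]
          exact ⟨hu.2.1.symm, hu.1, m1.symm, (hs _ _).trans q1⟩
    have hD1 := hD l1 hl1' l2 hl2' n1 n2 n12 r1 r2
    have hD2 := hD l2 hl2' l1 hl1' n2 n1 n12.symm r2 r1
    have disj : ∀ l ∈ N r v, ∀ l' ∈ N r v, u ≠ l → u ≠ l' → l ≠ l' → c u l = r → 
        ∀ x ∈ N b v, c l x = r → c l' x = r → False := by
      intro l hl l' hl' m1 m2 m12 q1 x hx e1 e2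
      have hx' := (memB x).1 hx
      have g1 := nRB l hl x hx
      have g2 := nRB l' hl' x hx
      rw [memR] at hl hl'
      exact h5 r v u l x l' hu.2.1 hl.2.1 hx'.2.1 hl'.2.1 m1 (nRB u hu' x hx) m2 g1 m12 g2.symm
        hu.2.2 q1 e1 ((hs _ _).trans e2) ((hs _ _).trans hl'.2.2)
    have memD : ∀ l x, x ∈ D l → c l x = r := by
      intro l x hx
      simp only [D, Finset.mem_erase, memN] at hx
      exact hx.2.2.2.2
    have cover : ∀ x ∈ N b v, c l1 x = r ∨ c l2 x = r := by
      have hdis : Disjoint (D l1) (D l2) := by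
        rw [Finset.disjoint_left]
        intro x hx1 hx2
        exact disj l1 hl1' l2 hl2' n1 n2 n12 r1 x (hD1.1 hx1) (memD _ _ hx1) (memD _ _ hx2)
      have heq : D l1 ∪ D l2 = N b v := by
        apply Finset.eq_of_subset_of_card_le (Finset.union_subset hD1.1 hD2.1)
        rw [Finset.card_union_of_disjoint hdis, hD1.2, hD2.2, (hNr v hv).2]
      intro x hx
      rw [← heq] at hx
      rcases Finset.mem_union.1 hx with h' | h'
      · exact Or.inl (memD _ _ h')
      · exact Or.inr (memD _ _ h')
    obtain ⟨z, hz, zv, zl1, zl2⟩ := ex4 (N r u) v l1 l2 (hNr u hu.1).1.ge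
    rw [memN] at hz
    rcases split z hz.1 zv.symm with hzR | hzB
    · -- third leaf
      have hz' := (memR z).1 hzR
      have hDz := hD z hzR l1 hl1' hz.2.1 n1 zl1 hz.2.2 r1
      obtain ⟨x, hx⟩ : (D z).Nonempty := Finset.card_pos.1 (by omega)
      rcases cover x (hDz.1 hx) with h' | h'
      · exact disj z hzR l1 hl1' hz.2.1 n1 zl1 hz.2.2 x (hDz.1 hx) (memD _ _ hx) h'
      · exact disj z hzR l2 hl2' hz.2.1 n2 zl2 hz.2.2 x (hDz.1 hx) (memD _ _ hx) h'
    · have gen : ∀ l ∈ N r v, ∀ l' ∈ N r v, u ≠ l → u ≠ l' → l ≠ l' → c u l' = r → 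
          c l z = r → False := by
        intro l hl l' hl' m1 m2 m12 q2 e
        have g1 := nRB l hl z hzB
        have g2 := nRB l' hl' z hzB
        rw [memR] at hl hl'
        exact h5 r v l' u z l hl'.2.1 hu.2.1 zv.symm hl.2.1 m2.symm g2 m12.symm hz.2.1 m1 g1.symm
          hl'.2.2 ((hs _ _).trans q2) hz.2.2 ((hs _ _).trans e) ((hs _ _).trans hl.2.2)
      rcases cover z hzB with h' | h'
      · exact gen l1 hl1' l2 hl2' n1 n2 n12 r2 h'
      · exact gen l2 hl2' l1 hl1' n2 n1 n12.symm r1 h'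
  · push Not at hadj
    obtain ⟨p, hp', q, hq', hpq, hcpq⟩ : ∃ p ∈ N r v, ∃ q ∈ N r v, p ≠ q ∧ c p q = r := by
      by_contra! hcon
      refine noK4 h h5 (r := r) (b := b) S (N r v) hS.ge hc (Finset.filter_subset _ _)
        (hNr v hv).1 ?_
      intro x hx y hy hxy
      exact (hc x ((memR x).1 hx).1 y ((memR y).1 hy).1 hxy).resolve_left (hcon x hx y hy hxy)
    obtain ⟨s, hs', sp, sq⟩ := ex3 (N r v) p q (by rw [(hNr v hv).1]; omega)
    have hp := (memR p).1 hp'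
    have hq := (memR q).1 hq'
    have hss := (memR s).1 hs'
    obtain ⟨x1, hx1, x1v, x1q⟩ := ex3 (N r p) v q (by rw [(hNr p hp.1).1]; omega)
    rw [memN] at hx1
    have hx1B : x1 ∈ N b v := by
      rcases split x1 hx1.1 x1v.symm with h' | h'
      · exact (hadj p hp' q hq' x1 h' hpq hx1.2.1 x1q.symm hcpq hx1.2.2).elim
      · exact h'
    obtain ⟨x3, hx3S, hx3B, hsx3, hcs⟩ : ∃ x ∈ S, x ∈ N b v ∧ s ≠ x ∧ c s x = r := by
      obtain ⟨z1, hz1, z1v⟩ := ex2 (N r s) v (by rw [(hNr s hss.1).1]; omega)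
      rw [memN] at hz1
      rcases split z1 hz1.1 z1v.symm with h' | h'
      · obtain ⟨z2, hz2, z2v, z21⟩ := ex3 (N r s) v z1 (by rw [(hNr s hss.1).1]; omega)
        rw [memN] at hz2
        rcases split z2 hz2.1 z2v.symm with h'' | h''
        · exact (hadj s hs' z1 h' z2 h'' hz1.2.1 hz2.2.1 z21.symm hz1.2.2 hz2.2.2).elim
        · exact ⟨z2, hz2.1, h'', hz2.2⟩
      · exact ⟨z1, hz1.1, h', hz1.2⟩
    have disj : ∀ x ∈ N b v, c p x = r → c s x = r → False := by
      intro x hx e1 e2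
      have hx' := (memB x).1 hx
      exact h5 r v q p x s hq.2.1 hp.2.1 hx'.2.1 hss.2.1 hpq.symm (nRB q hq' x hx) sq.symm
        (nRB p hp' x hx) sp.symm (nRB s hs' x hx).symm hq.2.2 ((hs _ _).trans hcpq) e1
        ((hs _ _).trans e2) ((hs _ _).trans hss.2.2)
    have bps : c p s = b := (hc p hp.1 s hss.1 sp.symm).resolve_left
      (hadj p hp' q hq' s hs' hpq sp.symm sq.symm hcpq)
    have bpx : c p x3 = b := (hc p hp.1 x3 hx3S (nRB p hp' x3 hx3B)).resolve_left
      (fun e => disj x3 hx3B e hcs)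
    have bsx : c s x1 = b := (hc s hss.1 x1 hx1.1 (nRB s hs' x1 hx1B)).resolve_left
      (fun e => disj x1 hx1B hx1.2.2 e)
    have ne13 : x3 ≠ x1 := by
      rintro rfl; exact disj _ hx1B hx1.2.2 hcs
    have hB1 := (memB x1).1 hx1B
    have hB3 := (memB x3).1 hx3B
    exact h5 b v x3 p s x1 hB3.2.1 hp.2.1 hss.2.1 hB1.2.1 (nRB p hp' x3 hx3B).symm
      (nRB s hs' x3 hx3B).symm ne13 sp.symm (nRB p hp' x1 hx1B) (nRB s hs' x1 hx1B) hB3.2.2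
      ((hs _ _).trans bpx) bps bsx ((hs _ _).trans hB1.2.2)

end GR

namespace GR

variable {V α : Type*}

/-- The case of a small neighbourhood `R`. -/
lemma Conf.small {c : V → V → α} [DecidableEq V] [DecidableEq α] {A R B S : Finset V} {r b : α}
    (h : Conf c A R B r b) (hS : S = A ∪ R ∪ B) (P : Finset α) (q : ℕ) (hq : 4 ≤ q)
    (hPq : 6 + P.card ≤ 2 * q) (hRn : 1 ≤ R.card) (hBn : 1 ≤ B.card)
    (hP : ∀ i ∈ P, NoP4 c S i) (hone : ¬ (R.card = 1 ∧ B.card = 1))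
    (ihr : ∀ X ⊂ S, Free c X r → X.card + (P.erase r).card ≤ q)
    (ihb : ∀ X ⊂ S, Free c X b → X.card + (P.erase b).card ≤ q)
    (hR : R.card ≤ 2) : S.card + P.card ≤ 2 * q := by
  have hs := h.gal.symm
  have ne := h.ne
  have e1 := h.nAR
  have e2 := h.swap.nAR
  have e3 := h.nRB
  have hA2 := h.hA
  obtain ⟨a, ha⟩ : A.Nonempty := Finset.card_pos.1 (by omega)
  obtain ⟨x0, hx0⟩ : B.Nonempty := Finset.card_pos.1 (by omega)
  obtain ⟨y0, hy0⟩ : R.Nonempty := Finset.card_pos.1 (by omega)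
  have hcS : S.card = A.card + R.card + B.card := by
    rw [hS, Finset.card_union_of_disjoint, Finset.card_union_of_disjoint h.dAR]
    rw [Finset.disjoint_union_left]; exact ⟨h.dAB, h.dRB⟩
  have sA : A ⊆ S := by rw [hS]; grind
  have sR : R ⊆ S := by rw [hS]; grind
  have sB : B ⊆ S := by rw [hS]; grind
  have ssub : ∀ X ⊆ S, ∀ y ∈ S, y ∉ X → X ⊂ S := fun X hX y hy hyX =>
    (Finset.ssubset_iff_of_subset hX).2 ⟨y, hy, hyX⟩
  have rP : 2 ≤ R.card → (P.erase r).card = P.card := by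
    intro h2
    rw [Finset.erase_eq_of_notMem]
    intro hr
    exact full_noP4 h.gal sA sR h.dAR h.fR hA2 h2 (hP r hr)
  have bP : 2 ≤ B.card → (P.erase b).card = P.card := by
    intro h2
    rw [Finset.erase_eq_of_notMem]
    intro hr
    exact full_noP4 h.gal sA sB h.dAB h.fB hA2 h2 (hP b hr)
  have ssA : A ⊂ S := ssub A sA y0 (sR hy0) (fun hh => e1 y0 hh y0 hy0 rfl)
  have ssB : B ⊂ S := ssub B sB y0 (sR hy0) (fun hh => e3 y0 hy0 y0 hh rfl)
  by_cases hB : B.card ≤ 2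
  · by_cases hA : A.card ≤ 2
    · omega
    · by_cases hR2 : R.card = 2
      · have f := full_free h.gal h.no5 h.dAR h.fR (by omega) (by omega)
        have := ihr A ssA f
        have := rP (by omega)
        omega
      · have hB2 : B.card = 2 := by omega
        have f := full_free h.gal h.no5 h.dAB h.fB (by omega) (by omega)
        have := ihb A ssA f
        have := bP (by omega)
        omega
  have hB3 : 3 ≤ B.card := by omega
  have bP := bP (by omega)
  have hBb : Free c B b := full_free h.gal h.no5 h.dAB.symm (h.fB.symm h.gal) hB3 h.hA
  have iB := ihb B ssB hBb
  by_cases hA : A.card ≤ 2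
  · omega
  have hAb : Free c A b := full_free h.gal h.no5 h.dAB h.fB (by omega) (by omega)
  by_cases hRb : Free c R b
  · have f : Free c (A ∪ R) b := by
      refine hAb.union h.gal hRb ?_
      intro u hu w hw
      rw [h.fR u hu w hw]; exact ne
    have := ihb (A ∪ R) (ssub _ (Finset.union_subset sA sR) x0 (sB hx0) (by
      intro hh
      rcases Finset.mem_union.1 hh with hh | hh
      · exact e2 x0 hh x0 hx0 rfl
      · exact e3 x0 hh x0 hx0 rfl)) f
    rw [Finset.card_union_of_disjoint h.dAR] at this
    omega
  unfold Free at hRb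
  push Not at hRb
  obtain ⟨y, hy, y', hy', hyy, hcy⟩ := hRb
  have hR2 : 2 ≤ R.card := Finset.one_lt_card.2 ⟨y, hy, y', hy', hyy⟩
  have rP := rP hR2
  have hRe : ∀ z ∈ R, z = y ∨ z = y' := by
    by_contra! hcon
    obtain ⟨z, hz, h1, h2⟩ := hcon
    have : 2 < R.card := Finset.two_lt_card.2 ⟨y, hy, y', hy', z, hz, hyy, h1.symm, h2.symm⟩
    omega
  -- if one of them has no blue neighbour in B
  have mv : ∀ w ∈ R, ∀ w' ∈ R, w ≠ w' → (∀ z ∈ R, z = w ∨ z = w') → (∀ x ∈ B, c w x ≠ b) →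
      S.card + P.card ≤ 2 * q := by
    intro w hw w' hw' hww hall hno
    have f1 : Free c (A ∪ {w'}) b := by
      refine hAb.union h.gal Free.single ?_
      intro u hu v hv
      rw [Finset.mem_singleton] at hv
      subst hv
      rw [h.fR u hu v hw']; exact ne
    have f2 : Free c (B ∪ {w}) b := by
      refine hBb.union h.gal Free.single ?_
      intro u hu v hv
      rw [Finset.mem_singleton] at hv
      subst hv
      rw [hs]; exact hno u hu
    have i1 := ihb _ (ssub (A ∪ {w'}) (Finset.union_subset sA (by simpa using sR hw')) w (sR hw) (by
      intro hh
      rcases Finset.mem_union.1 hh with hh | hh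
      · exact e1 w hh w hw rfl
      · exact hww (by simpa using hh))) f1
    have i2 := ihb _ (ssub (B ∪ {w}) (Finset.union_subset sB (by simpa using sR hw)) w' (sR hw') (by
      intro hh
      rcases Finset.mem_union.1 hh with hh | hh
      · exact e3 w' hw' w' hh rfl
      · exact hww (Finset.mem_singleton.1 hh).symm)) f2
    rw [Finset.card_union_of_disjoint (by
      rw [Finset.disjoint_singleton_right]; exact fun hh => e1 _ hh _ hw' rfl),
      Finset.card_singleton] at i1
    rw [Finset.card_union_of_disjoint (by
      rw [Finset.disjoint_singleton_right]; exact fun hh => e3 _ hw _ hh rfl),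
      Finset.card_singleton] at i2
    omega
  by_cases hn1 : ∀ x ∈ B, c y x ≠ b
  · exact mv y hy y' hy' hyy hRe hn1
  by_cases hn2 : ∀ x ∈ B, c y' x ≠ b
  · exact mv y' hy' y hy hyy.symm (fun z hz => (hRe z hz).symm) hn2
  push Not at hn1 hn2
  obtain ⟨x, hx, hcx⟩ := hn1
  obtain ⟨x', hx', hcx'⟩ := hn2
  have hxx : x = x' := by
    by_contra hne
    exact h.swap.matching hy hy' hx hx' hyy hne hcy hcx hcx'
  subst hxx
  have red : ∀ u ∈ B, u ≠ x → c y u = r ∧ c y' u = r := by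
    intro u hu hux
    constructor
    · rcases h.two y hy u hu with h' | h'
      · exact h'
      · exact (h.swap.matching hy hy' hu hx hyy hux hcy h' hcx').elim
    · rcases h.two y' hy' u hu with h' | h'
      · exact h'
      · exact (h.swap.matching hy hy' hx hu hyy hux.symm hcy hcx h').elim
  have dA : Disjoint A (B.erase x) := by
    rw [Finset.disjoint_left]
    intro u hu hu'
    exact e2 u hu u (Finset.mem_of_mem_erase hu') rfl
  have hcard : (A ∪ B.erase x).card = A.card + (B.card - 1) := by
    rw [Finset.card_union_of_disjoint dA, Finset.card_erase_of_mem hx]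
  have ffull : Full c (A ∪ B.erase x) R r := by
    intro u hu z hz
    rcases Finset.mem_union.1 hu with hu | hu
    · exact h.fR u hu z hz
    · rw [Finset.mem_erase] at hu
      rw [hs]
      rcases hRe z hz with rfl | rfl
      · exact (red u hu.2 hu.1).1
      · exact (red u hu.2 hu.1).2
  have fr : Free c (A ∪ B.erase x) r := by
    refine full_free h.gal h.no5 ?_ ffull (by omega) hR2
    rw [Finset.disjoint_left]
    intro u hu hu'
    rcases Finset.mem_union.1 hu with hu | hu
    · exact e1 u hu u hu' rfl
    · exact e3 u hu' u (Finset.mem_of_mem_erase hu) rfl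
  have := ihr _ (ssub (A ∪ B.erase x) (Finset.union_subset sA ((Finset.erase_subset _ _).trans sB))
    x (sB hx) (by
      intro hh
      rcases Finset.mem_union.1 hh with hh | hh
      · exact e2 x hh x hx rfl
      · simp at hh)) fr
  omega

lemma bip_bound {c : V → V → α} [DecidableEq V] {S : Finset V} {i : α} {p q : ℕ} (hb : Bip c S i)
    (ih : ∀ X ⊂ S, Free c X i → X.card + p ≤ q) : S.card + p ≤ 2 * q := by
  obtain ⟨X, Y, hS, hX, hY, fX, fY⟩ := hb
  have i1 := ih X (Finset.ssubset_iff_subset_ne.2 ⟨hS ▸ Finset.subset_union_left, hX⟩) fX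
  have i2 := ih Y (Finset.ssubset_iff_subset_ne.2 ⟨hS ▸ Finset.subset_union_right, hY⟩) fY
  have := Finset.card_union_le X Y
  rw [hS] at this
  omega

lemma Conf.bound {c : V → V → α} [DecidableEq V] [DecidableEq α] {A R B S : Finset V} {r b : α}
    (h : Conf c A R B r b) (hS : S = A ∪ R ∪ B) (P : Finset α) (q : ℕ) (hq : 4 ≤ q)
    (hPq : 6 + P.card ≤ 2 * q) (hRn : 1 ≤ R.card) (hBn : 1 ≤ B.card)
    (hP : ∀ i ∈ P, NoP4 c S i) (hone : ¬ (R.card = 1 ∧ B.card = 1))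
    (ihr : ∀ X ⊂ S, Free c X r → X.card + (P.erase r).card ≤ q)
    (ihb : ∀ X ⊂ S, Free c X b → X.card + (P.erase b).card ≤ q) : S.card + P.card ≤ 2 * q := by
  by_cases hR : R.card ≤ 2
  · exact h.small hS P q hq hPq hRn hBn hP hone ihr ihb hR
  by_cases hB : B.card ≤ 2
  · exact h.swap.small (by rw [hS]; ext z; simp only [Finset.mem_union]; tauto) P q hq hPq hBn hRn hP
      (by tauto) ihb ihr hB
  have sA : A ⊆ S := by rw [hS]; grind
  have sR : R ⊆ S := by rw [hS]; grind
  have sB : B ⊆ S := by rw [hS]; grind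
  have rP : P.erase r = P := by
    rw [Finset.erase_eq_of_notMem]
    intro hr
    exact full_noP4 h.gal sA sR h.dAR h.fR h.hA (by omega) (hP r hr)
  have bP : P.erase b = P := by
    rw [Finset.erase_eq_of_notMem]
    intro hr
    exact full_noP4 h.gal sA sB h.dAB h.fB h.hA (by omega) (hP b hr)
  rw [rP] at ihr
  rw [bP] at ihb
  have := h.large (by omega) (by omega)
  rw [← hS] at this
  rcases this with h' | h'
  · exact bip_bound h' ihr
  · exact bip_bound h' ihb

/-- The case of a monochromatic cut. -/
lemma cut_bound {c : V → V → α} [DecidableEq V] [DecidableEq α] (h : Gal c) (h5 : No5 c)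
    {X Y S : Finset V} {r : α} (hS : S = X ∪ Y) (hd : Disjoint X Y) (hf : Full c X Y r)
    (hXY : Y.card ≤ X.card) (hY : 1 ≤ Y.card) (P : Finset α) (q : ℕ)
    (hq2 : 2 ≤ q) (hPq : 3 + P.card ≤ 2 * q) (hPq' : r ∉ P → 4 + P.card ≤ 2 * q)
    (hP : ∀ i ∈ P, NoP4 c S i)
    (ihr : ∀ Z ⊂ S, Free c Z r → Z.card + (P.erase r).card ≤ q)
    (ihP : ∀ Z ⊂ S, NoP4 c Z r → r ∉ P → Z.card + (P.card + 1) ≤ 2 * q) :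
    S.card + P.card ≤ 2 * q := by
  have hs := h.symm
  have hc : S.card = X.card + Y.card := by rw [hS, Finset.card_union_of_disjoint hd]
  have nd : ∀ u ∈ X, ∀ v ∈ Y, u ≠ v := by
    rintro u hu v hv rfl; exact Finset.disjoint_left.1 hd hu hv
  have sX : X ⊆ S := by rw [hS]; grind
  have sY : Y ⊆ S := by rw [hS]; grind
  obtain ⟨y, hy⟩ : Y.Nonempty := Finset.card_pos.1 (by omega)
  obtain ⟨x, hx⟩ : X.Nonempty := Finset.card_pos.1 (by omega)
  have ssX : X ⊂ S := (Finset.ssubset_iff_of_subset sX).2 ⟨y, sY hy, fun hh => nd y hh y hy rfl⟩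
  have ssY : Y ⊂ S := (Finset.ssubset_iff_of_subset sY).2 ⟨x, sX hx, fun hh => nd x hx x hh rfl⟩
  by_cases hY1 : Y.card = 1
  · by_cases hr : r ∈ P
    · by_cases hX3 : 3 ≤ X.card
      · have fX : Free c X r := by
          intro u hu v hv huv hcu
          obtain ⟨z, hz, hzu, hzv⟩ := ex3 X u v hX3
          exact hP r hr z (sX hz) y (sY hy) u (sX hu) v (sX hv) (nd z hz y hy) hzu hzv
            (nd u hu y hy).symm (nd v hv y hy).symm huv (hf z hz y hy)
            ((hs _ _).trans (hf u hu y hy)) hcu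
        have i1 := ihr X ssX fX
        have := Finset.card_erase_of_mem hr
        omega
      · omega
    · have := ihP X ssX (by
        intro u hu v hv w hw z hz uv uw uz vw vz wz h1 h2 h3
        exact h5 r y u v w z (nd u hu y hy).symm (nd v hv y hy).symm (nd w hw y hy).symm
          (nd z hz y hy).symm uv uw uz vw vz wz ((hs _ _).trans (hf u hu y hy)) h1 h2 h3
          (hf z hz y hy)) hr
      omega
  have rP : r ∉ P := by
    intro hr
    exact full_noP4 h sX sY hd hf (by omega) (by omega) (hP r hr)
  rw [Finset.erase_eq_of_notMem rP] at ihr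
  have hPq' := hPq' rP
  by_cases hX3 : 3 ≤ X.card
  · have i1 := ihr X ssX (full_free h h5 hd hf hX3 (by omega))
    by_cases hY3 : 3 ≤ Y.card
    · have i2 := ihr Y ssY (full_free h h5 hd.symm (hf.symm h) hY3 (by omega))
      omega
    · omega
  · omega

theorem upper {c : V → V → α} [DecidableEq V] [DecidableEq α] (h : Gal c) (h5 : No5 c) (n : ℕ) :
    ∀ S : Finset V, S.card = n → ∀ K P : Finset α, P ⊆ K → 
      (∀ x ∈ S, ∀ y ∈ S, x ≠ y → c x y ∈ K) → (∀ i ∈ P, NoP4 c S i) → 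
      S.card + P.card ≤ 2 ^ (K.card + 1) := by
  induction n using Nat.strong_induction_on with
  | _ n ih =>
  intro S hn K P hPK hK hP
  have hs := h.symm
  have hk : P.card ≤ K.card := Finset.card_le_card hPK
  have hpow : K.card < 2 ^ K.card := Nat.lt_two_pow_self
  rw [pow_succ, mul_comm]
  by_cases h2 : S.card < 2
  · omega
  push Not at h2
  have ihf : ∀ i ∈ K, ∀ X ⊂ S, Free c X i → X.card + (P.erase i).card ≤ 2 ^ K.card := by
    intro i hi X hX hfree
    have := ih X.card (hn ▸ Finset.card_lt_card hX) X rfl (K.erase i) (P.erase i)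
      (Finset.erase_subset_erase _ hPK) (by
        intro x hx y hy hxy
        exact Finset.mem_erase.2 ⟨hfree x hx y hy hxy, hK x (hX.1 hx) y (hX.1 hy) hxy⟩) (by
        intro j hj x hx y hy z hz w hw
        exact hP j (Finset.mem_of_mem_erase hj) x (hX.1 hx) y (hX.1 hy) z (hX.1 hz) w (hX.1 hw))
    rwa [Finset.card_erase_add_one hi] at this
  have ihP : ∀ i ∈ K, ∀ X ⊂ S, NoP4 c X i → i ∉ P → X.card + (P.card + 1) ≤ 2 * 2 ^ K.card := by
    intro i hi X hX hno hiP
    have := ih X.card (hn ▸ Finset.card_lt_card hX) X rfl K (insert i P)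
      (Finset.insert_subset hi hPK) (fun x hx y hy hxy => hK x (hX.1 hx) y (hX.1 hy) hxy) (by
        intro j hj
        rcases Finset.mem_insert.1 hj with rfl | hj
        · exact hno
        · intro x hx y hy z hz w hw
          exact hP j hj x (hX.1 hx) y (hX.1 hy) z (hX.1 hz) w (hX.1 hw))
    rwa [Finset.card_insert_of_notMem hiP, pow_succ, mul_comm (2 ^ _)] at this
  -- monochromatic cuts
  by_cases hcut : ∃ i, Cut c S (· = i)
  · obtain ⟨i, X, hX, ⟨x, hx⟩, hXi⟩ := hcut
    obtain ⟨y, hy, hyX⟩ := Finset.exists_of_ssubset hX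
    have hiK : i ∈ K := by
      rw [← hXi x hx y hy hyX]
      exact hK x (hX.1 hx) y hy (by rintro rfl; exact hyX hx)
    have hK1 : 1 ≤ K.card := Finset.card_pos.2 ⟨i, hiK⟩
    have hf : Full c X (S \ X) i := by
      intro u hu v hv
      rw [Finset.mem_sdiff] at hv
      exact hXi u hu v hv.1 hv.2
    have hq2 : 2 ≤ 2 ^ K.card := by omega
    have hP4 : i ∉ P → 4 + P.card ≤ 2 * 2 ^ K.card := by
      intro hi
      have : P.card + 1 ≤ K.card := by
        rw [← Finset.card_insert_of_notMem hi]
        exact Finset.card_le_card (Finset.insert_subset hiK hPK)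
      omega
    have c1 : 1 ≤ X.card := Finset.card_pos.2 ⟨x, hx⟩
    have c2 : 1 ≤ (S \ X).card := Finset.card_pos.2 ⟨y, by simp [hy, hyX]⟩
    rcases le_total (S \ X).card X.card with hle | hle
    · exact cut_bound h h5 (Finset.union_sdiff_of_subset hX.1).symm Finset.disjoint_sdiff hf hle c2 P
        _ hq2 (by omega) hP4 hP (ihf i hiK) (ihP i hiK)
    · exact cut_bound h h5 (Finset.sdiff_union_of_subset hX.1).symm Finset.sdiff_disjoint
        (hf.symm h) hle c1 P _ hq2 (by omega) hP4 hP (ihf i hiK) (ihP i hiK)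
  push Not at hcut
  obtain ⟨r, b, X, hX, hXn, hXQ⟩ := gallai h S.card S rfl h2
  have hrb : r ≠ b := by
    rintro rfl
    exact hcut r ⟨X, hX, hXn, fun x hx y hy hyX => (hXQ x hx y hy hyX).elim id id⟩
  by_cases hall : ∀ x ∈ S, ∀ y ∈ S, x ≠ y → c x y = r ∨ c x y = b
  · -- two colors only
    -- every color is connected
    have edge : ∀ i j, (∀ x ∈ S, ∀ y ∈ S, x ≠ y → c x y = i ∨ c x y = j) → 
        ∀ Z ⊂ S, Z.Nonempty → ∃ x ∈ Z, ∃ y ∈ S, y ∉ Z ∧ c x y = i := by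
      intro i j hij Z hZ hZn
      by_contra! hcon
      refine hcut j ⟨Z, hZ, hZn, fun x hx y hy hyZ => ?_⟩
      exact (hij x (hZ.1 hx) y hy (by rintro rfl; exact hyZ hx)).resolve_left (hcon x hx y hy hyZ)
    have inK : ∀ i j, (∀ x ∈ S, ∀ y ∈ S, x ≠ y → c x y = i ∨ c x y = j) → i ∈ K := by
      intro i j hij
      obtain ⟨x, hx, y, hy, hyX, hc⟩ := edge i j hij X hX hXn
      rw [← hc]
      exact hK x (hX.1 hx) y hy (by rintro rfl; exact hyX hx)
    have notP : ∀ i j, i ≠ j → (∀ x ∈ S, ∀ y ∈ S, x ≠ y → c x y = i ∨ c x y = j) → i ∉ P := by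
      intro i j hne hij hi
      -- every vertex v has a path v u w
      have path : ∀ v ∈ S, ∃ u ∈ S, ∃ w ∈ S, v ≠ u ∧ v ≠ w ∧ u ≠ w ∧ c v u = i ∧ c u w = i ∧ 
          c v w ≠ i := by
        intro v hv
        let Z := S.filter fun x => x = v ∨ c v x = i
        have hvZ : v ∈ Z := by simp [Z, hv]
        have hZS : Z ⊂ S := by
          refine Finset.ssubset_iff_subset_ne.2 ⟨Finset.filter_subset _ _, ?_⟩
          intro he
          refine hcut i ⟨{v}, ?_, by simp, ?_⟩
          · obtain ⟨z, hz, hzv⟩ := ex2 S v h2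
            exact (Finset.ssubset_iff_of_subset (by simpa using hv)).2 ⟨z, hz, by simpa using hzv⟩
          · intro x hx y hy hyv
            simp at hx hyv
            subst hx
            have : y ∈ Z := he ▸ hy
            simp [Z, hyv] at this
            exact this.2
        obtain ⟨u, hu, w, hw, hwZ, hc⟩ := edge i j hij Z hZS ⟨v, hvZ⟩
        have hu' : u ∈ S ∧ (u = v ∨ c v u = i) := by simpa [Z] using hu
        have hw' : w ≠ v ∧ c v w ≠ i := by simpa [Z, hw] using hwZ
        have huv : u ≠ v := by
          rintro rfl
          exact hw'.2 hc
        exact ⟨u, hu'.1, w, hw, huv.symm, hw'.1.symm, by rintro rfl; exact hwZ hu,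
          hu'.2.resolve_left huv, hc, hw'.2⟩
      obtain ⟨v, hv⟩ : S.Nonempty := hXn.mono hX.1
      obtain ⟨u, hu, w, hw, vu, vw, uw, c1, c2, -⟩ := path v hv
      obtain ⟨u', hu', w', hw', d1, d2, d3, c3, c4, c5⟩ := path u hu
      by_cases hvu' : v = u'
      · subst hvu'
        have hww : w ≠ w' := by rintro rfl; exact c5 c2
        exact hP i hi w hw u hu v hv w' hw' uw.symm vw.symm hww vu.symm d2 d3
          ((hs _ _).trans c2) ((hs _ _).trans c1) c4
      · have hvw' : v ≠ w' := by rintro rfl; exact c5 ((hs _ _).trans c1)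
        exact hP i hi v hv u hu u' hu' w' hw' vu hvu' hvw' d1 d2 d3 c1 c3 c4
    have hall' : ∀ x ∈ S, ∀ y ∈ S, x ≠ y → c x y = b ∨ c x y = r := fun x hx y hy hxy =>
      (hall x hx y hy hxy).symm
    have rK := inK r b hall
    have bK := inK b r hall'
    have rP := notP r b hrb hall
    have bP := notP b r hrb.symm hall'
    have hcard : P.card + 2 ≤ K.card := by
      have : (insert r (insert b P)).card = P.card + 2 := by
        rw [Finset.card_insert_of_notMem (by simp [hrb, rP]), Finset.card_insert_of_notMem bP]
      rw [← this]
      exact Finset.card_le_card (Finset.insert_subset rK (Finset.insert_subset bK hPK))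
    have h8 : S.card ≤ 8 := by
      by_contra! h9
      obtain ⟨T, hT, hT9⟩ := Finset.exists_subset_card_eq (show 9 ≤ S.card from h9)
      exact r55 h h5 hrb T hT9 (fun x hx y hy hxy => hall x (hT hx) y (hT hy) hxy)
    have : ∀ k p : ℕ, p + 2 ≤ k → 8 + p ≤ 2 * 2 ^ k := by
      intro k p hkp
      obtain ⟨m, rfl⟩ := Nat.exists_eq_add_of_le hkp
      have : p + m < 2 ^ (p + m) := Nat.lt_two_pow_self
      have e : 2 ^ (p + 2 + m) = 4 * 2 ^ (p + m) := by
        rw [show p + 2 + m = (p + m) + 2 by ring, pow_add]; ring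
      omega
    have := this _ _ hcard
    omega
  push Not at hall
  obtain ⟨s, hsS, t, htS, hst, hcst⟩ := hall
  obtain ⟨A, hA, hsA, hAQ, hAh⟩ := min_module h (fun e => e = r ∨ e = b) S X s hX hXn hXQ hsS
  have htA : t ∈ A := by
    by_contra htA
    rcases hAQ s hsA t htS htA with h' | h'
    · exact hcst.1 h'
    · exact hcst.2 h'
  let R := S.filter fun z => z ∉ A ∧ c s z = r
  let B := S.filter fun z => z ∉ A ∧ c s z = b
  have memR : ∀ z, z ∈ R ↔ z ∈ S ∧ z ∉ A ∧ c s z = r := by intro z; simp [R]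
  have memB : ∀ z, z ∈ B ↔ z ∈ S ∧ z ∉ A ∧ c s z = b := by intro z; simp [B]
  have hA2 : 2 ≤ A.card := Finset.one_lt_card.2 ⟨s, hsA, t, htA, hst⟩
  have hunion : S = A ∪ R ∪ B := by
    ext z
    simp only [Finset.mem_union, memR, memB]
    constructor
    · intro hz
      by_cases hzA : z ∈ A
      · exact Or.inl (Or.inl hzA)
      · rcases hAQ s hsA z hz hzA with h' | h'
        · exact Or.inl (Or.inr ⟨hz, hzA, h'⟩)
        · exact Or.inr ⟨hz, hzA, h'⟩
    · rintro ((h' | h') | h')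
      · exact hA.1 h'
      · exact h'.1
      · exact h'.1
  have conf : Conf c A R B r b := by
    refine ⟨h, h5, hrb, ?_, ?_, ?_, ?_, ?_, ?_, hA2⟩
    · rw [Finset.disjoint_left]; intro z hz hz'; exact ((memR z).1 hz').2.1 hz
    · rw [Finset.disjoint_left]; intro z hz hz'; exact ((memB z).1 hz').2.1 hz
    · rw [Finset.disjoint_left]; intro z hz hz'
      exact hrb (((memR z).1 hz).2.2.symm.trans ((memB z).1 hz').2.2)
    · intro x hx z hz
      have hz := (memR z).1 hz
      rw [hs, hAh z hz.1 hz.2.1 x hx s hsA, hs]; exact hz.2.2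
    · intro x hx z hz
      have hz := (memB z).1 hz
      rw [hs, hAh z hz.1 hz.2.1 x hx s hsA, hs]; exact hz.2.2
    · intro y hy x hx
      have hy := (memR y).1 hy
      have hx := (memB x).1 hx
      have n1 : s ≠ y := by rintro rfl; exact hy.2.1 hsA
      have n2 : s ≠ x := by rintro rfl; exact hx.2.1 hsA
      have n3 : y ≠ x := by rintro rfl; exact hrb (hy.2.2.symm.trans hx.2.2)
      have := h.tri s y x n1 n2 n3
      rw [hy.2.2, hx.2.2] at this
      rcases this with h' | h' | h'
      · exact absurd h' hrb
      · exact Or.inl h'.symm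
      · exact Or.inr h'.symm
  have hBn : B.Nonempty := by
    by_contra hne
    rw [Finset.not_nonempty_iff_eq_empty] at hne
    refine hcut r ⟨A, hA, ⟨s, hsA⟩, fun x hx y hy hyA => ?_⟩
    have : y ∈ A ∪ R ∪ B := hunion ▸ hy
    rw [hne] at this
    simp [hyA] at this
    exact conf.fR x hx y this
  have hRn : R.Nonempty := by
    by_contra hne
    rw [Finset.not_nonempty_iff_eq_empty] at hne
    refine hcut b ⟨A, hA, ⟨s, hsA⟩, fun x hx y hy hyA => ?_⟩
    have : y ∈ A ∪ R ∪ B := hunion ▸ hy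
    rw [hne] at this
    simp [hyA] at this
    exact conf.fB x hx y this
  have hone : ¬ (R.card = 1 ∧ B.card = 1) := by
    rintro ⟨h1, h1'⟩
    obtain ⟨y, hy⟩ := Finset.card_eq_one.1 h1
    obtain ⟨x, hx⟩ := Finset.card_eq_one.1 h1'
    have yR : y ∈ R := by simp [hy]
    have xB : x ∈ B := by simp [hx]
    have gen : ∀ i u, u ∈ S → u ∉ A → (∀ z ∈ S, z ≠ u → c u z = i) → False := by
      intro i u hu huA hall
      refine hcut i ⟨{u}, ?_, by simp, ?_⟩
      · exact (Finset.ssubset_iff_of_subset (by simpa using hu)).2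
          ⟨s, hsS, by simp; rintro rfl; exact huA hsA⟩
      · intro v hv z hz hzv
        simp at hv hzv
        subst hv
        exact hall z hz hzv
    have mem : ∀ z ∈ S, z ∈ A ∨ z = y ∨ z = x := by
      intro z hz
      rw [hunion, hy, hx] at hz
      simp at hz
      tauto
    rcases conf.two y yR x xB with h' | h'
    · refine gen r y ((memR y).1 yR).1 ((memR y).1 yR).2.1 ?_
      intro z hz hzy
      rcases mem z hz with hz | hz | hz
      · rw [hs]; exact conf.fR z hz y yR
      · exact absurd hz hzy
      · rw [hz]; exact h'
    · refine gen b x ((memB x).1 xB).1 ((memB x).1 xB).2.1 ?_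
      intro z hz hzy
      rcases mem z hz with hz | hz | hz
      · rw [hs]; exact conf.fB z hz x xB
      · rw [hz, hs]; exact h'
      · exact absurd hz hzy
  have rK : r ∈ K := by
    obtain ⟨y, hy⟩ := hRn
    have hy := (memR y).1 hy
    rw [← hy.2.2]
    exact hK s hsS y hy.1 (by rintro rfl; exact hy.2.1 hsA)
  have bK : b ∈ K := by
    obtain ⟨y, hy⟩ := hBn
    have hy := (memB y).1 hy
    rw [← hy.2.2]
    exact hK s hsS y hy.1 (by rintro rfl; exact hy.2.1 hsA)
  have hK2 : 2 ≤ K.card := Finset.one_lt_card.2 ⟨r, rK, b, bK, hrb⟩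
  have hnum : ∀ k : ℕ, 2 ≤ k → 4 ≤ 2 ^ k ∧ 6 + k ≤ 2 * 2 ^ k := by
    intro k hk
    obtain ⟨m, rfl⟩ := Nat.exists_eq_add_of_le hk
    have : m < 2 ^ m := Nat.lt_two_pow_self
    rw [pow_add]
    omega
  obtain ⟨hn1, hn2⟩ := hnum _ hK2
  exact conf.bound hunion P _ hn1 (by omega) (Finset.card_pos.2 hRn) (Finset.card_pos.2 hBn) hP hone
    (ihf r rK) (ihf b bK)

end GR

namespace GR

lemma upper_grProp (k n : ℕ) (hn : 2 ^ (k + 1) + 1 ≤ n) : grProp k (cycleGraph 5) n := by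
  intro c
  by_contra hcon
  push Not at hcon
  obtain ⟨hR, hM⟩ := hcon
  have hG : Gal (fun x y => c s(x, y)) := by
    refine ⟨fun x y => by simp only [Sym2.eq_swap], ?_⟩
    intro x y z hxy hxz hyz
    by_contra hc
    push Not at hc
    exact hR ⟨x, y, z, hxy, hxz, hyz, hc.1, hc.2.1, hc.2.2⟩
  have h5 : No5 (fun x y => c s(x, y)) := by
    intro i x1 x2 x3 x4 x5 h12 h13 h14 h15 h23 h24 h25 h34 h35 h45 e1 e2 e3 e4 e5
    apply hM
    refine ⟨i, ⟨![x1, x2, x3, x4, x5], ?_⟩, ?_⟩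
    · intro a b hab
      fin_cases a <;> fin_cases b <;> simp_all
    · intro u v huv
      have f1 := e1; have f2 := e2; have f3 := e3; have f4 := e4; have f5 := e5
      simp only [Sym2.eq_swap] at f1 f2 f3 f4 f5
      have hadj : u.val + 1 = v.val ∨ v.val + 1 = u.val ∨ (u.val = 0 ∧ v.val = 4) ∨
          (u.val = 4 ∧ v.val = 0) := by
        revert u v
        decide
      have g1 : c s(x2, x1) = i := by rw [Sym2.eq_swap]; exact e1
      have g2 : c s(x3, x2) = i := by rw [Sym2.eq_swap]; exact e2
      have g3 : c s(x4, x3) = i := by rw [Sym2.eq_swap]; exact e3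
      have g4 : c s(x5, x4) = i := by rw [Sym2.eq_swap]; exact e4
      have g5 : c s(x1, x5) = i := by rw [Sym2.eq_swap]; exact e5
      clear huv
      fin_cases u <;> fin_cases v <;> first | (exfalso; revert hadj; decide) | assumption
  have := upper hG h5 n Finset.univ (by simp) Finset.univ ∅ (by simp) (by simp) (by simp)
  simp at this
  omega

lemma exD (x y : ℕ) : ∃ j, x / 2 ^ (j + 2) = y / 2 ^ (j + 2) := by
  refine ⟨x + y, ?_⟩
  have h : x + y < 2 ^ (x + y + 2) :=
    lt_of_lt_of_le Nat.lt_two_pow_self (Nat.pow_le_pow_right (by norm_num) (by omega))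
  rw [Nat.div_eq_of_lt (by omega), Nat.div_eq_of_lt (by omega)]

/-- Level at which `x` and `y` merge. -/
noncomputable def D (x y : ℕ) : ℕ := Nat.find (exD x y)

lemma D_le_iff (x y j : ℕ) : D x y ≤ j ↔ x / 2 ^ (j + 2) = y / 2 ^ (j + 2) := by
  constructor
  · intro h
    have h1 : x / 2 ^ (D x y + 2) = y / 2 ^ (D x y + 2) := Nat.find_spec (exD x y)
    obtain ⟨m, rfl⟩ := Nat.exists_eq_add_of_le h
    have : 2 ^ (D x y + m + 2) = 2 ^ (D x y + 2) * 2 ^ m := by ring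
    rw [this, ← Nat.div_div_eq_div_mul, ← Nat.div_div_eq_div_mul, h1]
  · intro h
    exact Nat.find_min' _ h

lemma D_comm (x y : ℕ) : D x y = D y x := by
  apply le_antisymm
  · rw [D_le_iff]; exact ((D_le_iff y x _).1 le_rfl).symm
  · rw [D_le_iff]; exact ((D_le_iff x y _).1 le_rfl).symm

lemma D_ultra (x y z : ℕ) : D x z ≤ max (D x y) (D y z) := by
  rw [D_le_iff]
  exact ((D_le_iff x y _).1 (le_max_left _ _)).trans ((D_le_iff y z _).1 (le_max_right _ _))

lemma D_parity (x y i : ℕ) (h : D x y = i + 1) :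
    (x / 2 ^ (i + 2)) % 2 ≠ (y / 2 ^ (i + 2)) % 2 := by
  have h1 := (D_le_iff x y (i + 1)).1 h.le
  have h2 : ¬ D x y ≤ i := by omega
  rw [D_le_iff] at h2
  have : 2 ^ (i + 1 + 2) = 2 ^ (i + 2) * 2 := by ring
  rw [this, ← Nat.div_div_eq_div_mul, ← Nat.div_div_eq_div_mul] at h1
  omega

lemma D_lt (k x y : ℕ) (hk : 1 ≤ k) (hx : x < 2 ^ (k + 1)) (hy : y < 2 ^ (k + 1)) :
    D x y < k := by
  have : D x y ≤ k - 1 := by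
    rw [D_le_iff]
    have : k - 1 + 2 = k + 1 := by omega
    rw [this, Nat.div_eq_of_lt hx, Nat.div_eq_of_lt hy]
  omega

lemma lower_grProp (k : ℕ) (hk : 1 ≤ k) : ¬ grProp k (cycleGraph 5) (2 ^ (k + 1)) := by
  intro hp
  let c : Sym2 (Fin (2 ^ (k + 1))) → Fin k := Sym2.lift
    ⟨fun x y => ⟨D x y, D_lt k x y hk x.2 y.2⟩, fun x y => by simp only [D_comm]⟩
  have hc : ∀ x y, ((c s(x, y) : Fin k) : ℕ) = D x y := fun x y => rfl
  rcases hp c with ⟨x, y, z, -, -, -, h1, h2, h3⟩ | ⟨i, f, hf⟩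
  · rw [Ne, Fin.ext_iff, hc, hc] at h1 h2 h3
    have u1 := D_ultra x y z
    have u2 := D_ultra x z y
    have u3 := D_ultra y x z
    rw [D_comm z y] at u2
    rw [D_comm y x] at u3
    omega
  · have hD : ∀ u v : Fin 5, (cycleGraph 5).Adj u v → D (f u) (f v) = i := by
      intro u v h
      rw [← hc, hf u v h]
    have e1 := hD 0 1 (by decide)
    have e2 := hD 1 2 (by decide)
    have e3 := hD 2 3 (by decide)
    have e4 := hD 3 4 (by decide)
    have e5 := hD 4 0 (by decide)
    have hne : ∀ u v : Fin 5, u ≠ v → (f u : ℕ) ≠ f v := by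
      intro u v h hh
      exact h (f.injective (Fin.ext hh))
    rcases hi : (i : ℕ) with _ | j
    · rw [hi] at e1 e2 e3 e4 e5
      have q1 := (D_le_iff _ _ 0).1 e1.le
      have q2 := (D_le_iff _ _ 0).1 e2.le
      have q3 := (D_le_iff _ _ 0).1 e3.le
      have q4 := (D_le_iff _ _ 0).1 e4.le
      norm_num at q1 q2 q3 q4
      have a1 := hne 0 1 (by decide)
      have a2 := hne 0 2 (by decide)
      have a3 := hne 0 3 (by decide)
      have a4 := hne 0 4 (by decide)
      have a5 := hne 1 2 (by decide)
      have a6 := hne 1 3 (by decide)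
      have a7 := hne 1 4 (by decide)
      have a8 := hne 2 3 (by decide)
      have a9 := hne 2 4 (by decide)
      have a10 := hne 3 4 (by decide)
      omega
    · rw [hi] at e1 e2 e3 e4 e5
      have q1 := D_parity _ _ _ e1
      have q2 := D_parity _ _ _ e2
      have q3 := D_parity _ _ _ e3
      have q4 := D_parity _ _ _ e4
      have q5 := D_parity _ _ _ e5
      omega

end GR

theorem gallai_ramsey_C5 (k : ℕ) (hk : 2 ≤ k) :
    gr k (cycleGraph 5) = 2 ^ (k + 1) + 1 := by
  have hmem : (2 ^ (k + 1) + 1) ∈ {N | ∀ n, N ≤ n → grProp k (cycleGraph 5) n} :=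
    fun n hn => GR.upper_grProp k n hn
  apply le_antisymm
  · exact Nat.sInf_le hmem
  · apply le_csInf ⟨_, hmem⟩
    intro N hN
    by_contra hlt
    exact GR.lower_grProp k (by omega) (hN _ (by omega))
end
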